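/- arXiv:math/0010016 — 2 statements merged into one kernel-verified Lean document; each statement's English description precedes it below -/
import Mathlib

section
/- Let u ∈ P₁(0,M), let r_j → 0⁺, and suppose that the rescalings u_j(x) = u(r_j·x)/r_j² converge uniformly on compact subsets of ℝ^N to a continuously differentiable function u₀, with ∇u_j → ∇u₀ uniformly on compact sets as well. Then u₀ is homogeneous of degree two: u₀(λx) = λ²·u₀(x) for all λ > 0 and all x ∈ ℝ^N; in particular the set {x : u₀(x) = 0 and ∇u₀(x) = 0} is a cone (closed under multiplication by positive scalars). -/
open MeasureTheory Metric Set Filter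
open scoped RealInnerProductSpace

noncomputable section

/-- The Laplacian of `φ` at `x`, as the sum of the pure second derivatives. -/
def lap (N : ℕ) (φ : EuclideanSpace ℝ (Fin N) → ℝ) (x : EuclideanSpace ℝ (Fin N)) : ℝ :=
  ∑ i : Fin N,
    fderiv ℝ (fun y => fderiv ℝ φ y (EuclideanSpace.single i 1)) x (EuclideanSpace.single i 1)

/-- Membership in the class `P_r(z, M)`. -/
def MemP (N : ℕ) (r : ℝ) (z : EuclideanSpace ℝ (Fin N)) (M : ℝ)
    (Ω : Set (EuclideanSpace ℝ (Fin N))) (u : EuclideanSpace ℝ (Fin N) → ℝ) : Prop :=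
  IsOpen Ω ∧ ContDiff ℝ 1 u ∧
    (∀ φ : EuclideanSpace ℝ (Fin N) → ℝ, ContDiff ℝ (⊤ : ℕ∞) φ → tsupport φ ⊆ ball z r →
      ∫ x, u x * lap N φ x = ∫ x in Ω, φ x) ∧
    (∀ x ∈ ball z r \ Ω, u x = 0 ∧ gradient u x = 0) ∧
    (∀ x ∈ ball z r, |u x| ≤ M) ∧
    z ∈ frontier Ω

/-- Membership in the class `P_∞(0, M)` of global solutions with quadratic growth. -/
def MemPinf (N : ℕ) (M : ℝ) (Ω : Set (EuclideanSpace ℝ (Fin N)))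
    (u : EuclideanSpace ℝ (Fin N) → ℝ) : Prop :=
  IsOpen Ω ∧ ContDiff ℝ 1 u ∧
    (∀ φ : EuclideanSpace ℝ (Fin N) → ℝ, ContDiff ℝ (⊤ : ℕ∞) φ → HasCompactSupport φ →
      ∫ x, u x * lap N φ x = ∫ x in Ω, φ x) ∧
    (∀ x ∈ Ωᶜ, u x = 0 ∧ gradient u x = 0) ∧
    (0 : EuclideanSpace ℝ (Fin N)) ∈ frontier Ω ∧
    (∀ x, |u x| ≤ M * (‖x‖ ^ 2 + 1))

/-- The minimum diameter of a set: the smallest width of a slab containing it. -/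
def MD (N : ℕ) (D : Set (EuclideanSpace ℝ (Fin N))) : ℝ :=
  ⨅ e : {e : EuclideanSpace ℝ (Fin N) // ‖e‖ = 1},
    ((⨆ x : D, ⟪(x : EuclideanSpace ℝ (Fin N)), (e : EuclideanSpace ℝ (Fin N))⟫) -
      ⨅ x : D, ⟪(x : EuclideanSpace ℝ (Fin N)), (e : EuclideanSpace ℝ (Fin N))⟫)

/-- The density function `δ_r(u)`. -/
def deltaFn (N : ℕ) (u : EuclideanSpace ℝ (Fin N) → ℝ) (r : ℝ) : ℝ :=
  MD N ({x | u x = 0 ∧ gradient u x = 0} ∩ ball 0 r) / r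

/-- Half-space solutions `x ↦ (max(⟪x,e⟫,0))²/2`. -/
def IsHalfSpaceSol (N : ℕ) (u : EuclideanSpace ℝ (Fin N) → ℝ) : Prop :=
  ∃ e : EuclideanSpace ℝ (Fin N), ‖e‖ = 1 ∧ ∀ x, u x = (max ⟪x, e⟫ 0) ^ 2 / 2

/-- `∂Ω ∩ B` is the graph of a `C¹` function. -/
def IsC1Graph (N : ℕ) (Ω B : Set (EuclideanSpace ℝ (Fin N))) : Prop :=
  ∃ (e : EuclideanSpace ℝ (Fin N)) (f : EuclideanSpace ℝ (Fin N) → ℝ),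
    ‖e‖ = 1 ∧ ContDiff ℝ 1 f ∧
    Ω ∩ B = {x ∈ B | f (x - ⟪x, e⟫ • e) < ⟪x, e⟫} ∧
    frontier Ω ∩ B = {x ∈ B | ⟪x, e⟫ = f (x - ⟪x, e⟫ • e)}

/-- `∂Ω ∩ B` is the graph of a real-analytic function. -/
def IsAnalyticGraph (N : ℕ) (Ω B : Set (EuclideanSpace ℝ (Fin N))) : Prop :=
  ∃ (e : EuclideanSpace ℝ (Fin N)) (f : EuclideanSpace ℝ (Fin N) → ℝ),
    ‖e‖ = 1 ∧ (∀ x, AnalyticAt ℝ f x) ∧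
    Ω ∩ B = {x ∈ B | f (x - ⟪x, e⟫ • e) < ⟪x, e⟫} ∧
    frontier Ω ∩ B = {x ∈ B | ⟪x, e⟫ = f (x - ⟪x, e⟫ • e)}

/-- The Alt–Caffarelli–Friedman functional `φ(r, v)` centered at the origin. -/
def acf (N : ℕ) (v : EuclideanSpace ℝ (Fin N) → ℝ) (r : ℝ) : ℝ :=
  r ^ (-4 : ℤ) *
    (∫ x in ball (0 : EuclideanSpace ℝ (Fin N)) r,
      ‖gradient (fun y => max (v y) 0) x‖ ^ 2 * ‖x‖ ^ ((2 : ℤ) - (N : ℤ))) *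
    ∫ x in ball (0 : EuclideanSpace ℝ (Fin N)) r,
      ‖gradient (fun y => max (-v y) 0) x‖ ^ 2 * ‖x‖ ^ ((2 : ℤ) - (N : ℤ))

/-- `S_j(z, u) = sup_{B(z, 2^{-j})} |u|`. -/
def Sj (N : ℕ) (z : EuclideanSpace ℝ (Fin N)) (u : EuclideanSpace ℝ (Fin N) → ℝ) (j : ℕ) : ℝ :=
  sSup ((fun x => |u x|) '' ball z ((2 : ℝ) ^ (-(j : ℤ))))

section Weiss

open Function Topology

lemma hasDerivAt_max_zero_pow (n : ℕ) (t : ℝ) :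
    HasDerivAt (fun s : ℝ => max s 0 ^ (n + 2)) ((n + 2) * max t 0 ^ (n + 1)) t := by
  rcases lt_trichotomy t 0 with h | h | h
  · have : (fun s : ℝ => max s 0 ^ (n + 2)) =ᶠ[𝓝 t] fun _ => 0 := by
      filter_upwards [Iio_mem_nhds h] with s hs
      simp [max_eq_right (mem_Iio.1 hs).le]
    rw [max_eq_right h.le]
    simpa using (hasDerivAt_const t (0 : ℝ)).congr_of_eventuallyEq this
  · subst h
    rw [hasDerivAt_iff_isLittleO_nhds_zero]
    have h2 : (fun h : ℝ => h ^ (n + 2)) =o[𝓝 0] fun h : ℝ => h := by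
      simpa using Asymptotics.isLittleO_pow_id (𝕜 := ℝ) (n := n + 2) (by omega)
    refine Asymptotics.IsBigO.trans_isLittleO ?_ h2
    refine Asymptotics.IsBigO.of_bound 1 (Eventually.of_forall fun s => ?_)
    simp only [zero_add, max_self, ne_eq, Nat.add_eq_zero_iff, OfNat.ofNat_ne_zero, and_false,
      not_false_eq_true, zero_pow, sub_zero, one_ne_zero, mul_zero, smul_eq_mul, one_mul, norm_pow,
      Real.norm_eq_abs]
    exact pow_le_pow_left₀ (abs_nonneg _)
      (by simpa [max_comm] using abs_max_sub_max_le_abs s 0 0) _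
  · have : (fun s : ℝ => max s 0 ^ (n + 2)) =ᶠ[𝓝 t] fun s => s ^ (n + 2) := by
      filter_upwards [Ioi_mem_nhds h] with s hs
      rw [max_eq_left (mem_Ioi.1 hs).le]
    rw [max_eq_left h.le]
    have := (hasDerivAt_pow (n + 2) t).congr_of_eventuallyEq this
    simpa using this

section TruncWeight

variable {E : Type*} [NormedAddCommGroup E]

/-- The truncated weight `(r² - ‖x‖²)₊`. -/
def truncWeight (r : ℝ) (x : E) : ℝ := max (r ^ 2 - ‖x‖ ^ 2) 0

lemma truncWeight_eq_zero {r : ℝ} (hr : 0 ≤ r) {x : E} (hx : r ≤ ‖x‖) : truncWeight r x = 0 := by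
  unfold truncWeight
  rw [max_eq_right]
  nlinarith

lemma truncWeight_pos {r : ℝ} {x : E} (hx : ‖x‖ < r) : 0 < truncWeight r x := by
  unfold truncWeight
  rw [lt_max_iff]
  left
  nlinarith [norm_nonneg x]

lemma norm_sq_mul_truncWeight (r : ℝ) (x : E) :
    ‖x‖ ^ 2 * truncWeight r x = r ^ 2 * truncWeight r x - truncWeight r x ^ 2 := by
  unfold truncWeight
  rcases le_total (r ^ 2 - ‖x‖ ^ 2) 0 with h | h
  · simp [max_eq_right h]
  · rw [max_eq_left h]; ring

lemma continuous_truncWeight : Continuous fun z : ℝ × E => truncWeight z.1 z.2 := by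
  unfold truncWeight; fun_prop

lemma hasDerivAt_truncWeight_pow (n : ℕ) (r : ℝ) (x : E) :
    HasDerivAt (fun s => truncWeight s x ^ (n + 2))
      ((n + 2) * truncWeight r x ^ (n + 1) * (2 * r)) r := by
  have h := (hasDerivAt_max_zero_pow n (r ^ 2 - ‖x‖ ^ 2)).comp r
    ((hasDerivAt_pow 2 r).sub_const (‖x‖ ^ 2))
  simpa [truncWeight, comp_def] using h

lemma truncWeight_smul [NormedSpace ℝ E] (s : ℝ) (r : ℝ) (x : E) :
    truncWeight (s * r) (s • x) = s ^ 2 * truncWeight r x := by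
  unfold truncWeight
  rw [norm_smul, Real.norm_eq_abs, mul_pow, mul_pow, sq_abs, ← mul_sub,
    mul_max_of_nonneg _ _ (sq_nonneg s), mul_zero]

end TruncWeight

section Densities

variable {E : Type*} [NormedAddCommGroup E]

/-- The integrand of the smoothed Weiss functional. -/
def weissDensity (r : ℝ) (q : ℝ × E) (x : E) : ℝ :=
  (‖q.2‖ ^ 2 + 2 * q.1) * truncWeight r x ^ 3 - 12 * q.1 ^ 2 * truncWeight r x ^ 2

/-- The derivative in `r` of `weissDensity`. -/
def weissDensityDeriv (r : ℝ) (q : ℝ × E) (x : E) : ℝ :=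
  2 * r * (3 * (‖q.2‖ ^ 2 + 2 * q.1) * truncWeight r x ^ 2 - 24 * q.1 ^ 2 * truncWeight r x)

lemma hasDerivAt_weissDensity (r : ℝ) (q : ℝ × E) (x : E) :
    HasDerivAt (fun s => weissDensity s q x) (weissDensityDeriv r q x) r := by
  have h := ((hasDerivAt_truncWeight_pow 1 r x).const_mul (‖q.2‖ ^ 2 + 2 * q.1)).sub
    ((hasDerivAt_truncWeight_pow 0 r x).const_mul (12 * q.1 ^ 2))
  refine h.congr_deriv ?_
  simp only [weissDensityDeriv]
  push_cast
  ring

lemma continuous_weissDensity :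
    Continuous fun z : ℝ × (ℝ × E) × E => weissDensity z.1 z.2.1 z.2.2 := by
  have h : Continuous fun z : ℝ × (ℝ × E) × E => truncWeight z.1 z.2.2 :=
    continuous_truncWeight.comp (f := fun z : ℝ × (ℝ × E) × E => (z.1, z.2.2)) (by fun_prop)
  unfold weissDensity; fun_prop

lemma continuous_weissDensityDeriv :
    Continuous fun z : ℝ × (ℝ × E) × E => weissDensityDeriv z.1 z.2.1 z.2.2 := by
  have h : Continuous fun z : ℝ × (ℝ × E) × E => truncWeight z.1 z.2.2 :=
    continuous_truncWeight.comp (f := fun z : ℝ × (ℝ × E) × E => (z.1, z.2.2)) (by fun_prop)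
  unfold weissDensityDeriv; fun_prop

lemma weissDensity_eq_zero {r : ℝ} (hr : 0 ≤ r) (q : ℝ × E) {x : E} (hx : r ≤ ‖x‖) :
    weissDensity r q x = 0 := by
  simp [weissDensity, truncWeight_eq_zero hr hx]

lemma weissDensityDeriv_eq_zero {r : ℝ} (hr : 0 ≤ r) (q : ℝ × E) {x : E} (hx : r ≤ ‖x‖) :
    weissDensityDeriv r q x = 0 := by
  simp [weissDensityDeriv, truncWeight_eq_zero hr hx]

variable [InnerProductSpace ℝ E]

/-- The radial defect `x · ∇u - 2 * u`, as a function of `(u, ∇u)` and `x`. It vanishes identically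
exactly when `u` is homogeneous of degree two. -/
def radialDefect (q : ℝ × E) (x : E) : ℝ := ⟪q.2, x⟫ - 2 * q.1

/-- The integrand whose integral vanishes for solutions: it expresses the derivative of the
Weiss functional through the radial defect. -/
def weissResidual (m r : ℝ) (q : ℝ × E) (x : E) : ℝ :=
  m * weissDensity r q x - r * weissDensityDeriv r q x +
    12 * truncWeight r x ^ 2 * radialDefect q x ^ 2

lemma continuous_radialDefect : Continuous fun z : (ℝ × E) × E => radialDefect z.1 z.2 := by
  unfold radialDefect; fun_prop

lemma continuous_weissResidual (m : ℝ) :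
    Continuous fun z : ℝ × (ℝ × E) × E => weissResidual m z.1 z.2.1 z.2.2 := by
  have h : Continuous fun z : ℝ × (ℝ × E) × E => truncWeight z.1 z.2.2 :=
    continuous_truncWeight.comp (f := fun z : ℝ × (ℝ × E) × E => (z.1, z.2.2)) (by fun_prop)
  have h1 := continuous_weissDensity (E := E)
  have h2 := continuous_weissDensityDeriv (E := E)
  have h3 : Continuous fun z : ℝ × (ℝ × E) × E => radialDefect z.2.1 z.2.2 :=
    continuous_radialDefect.comp (f := fun z : ℝ × (ℝ × E) × E => z.2) (by fun_prop)
  unfold weissResidual; fun_prop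

lemma weissResidual_eq_zero (m : ℝ) {r : ℝ} (hr : 0 ≤ r) (q : ℝ × E) {x : E} (hx : r ≤ ‖x‖) :
    weissResidual m r q x = 0 := by
  simp [weissResidual, weissDensity_eq_zero hr q hx, weissDensityDeriv_eq_zero hr q hx,
    truncWeight_eq_zero hr hx]

lemma weissDensity_smul (s r : ℝ) (t : ℝ) (p x : E) :
    weissDensity (s * r) (s ^ 2 * t, s • p) (s • x) = s ^ 8 * weissDensity r (t, p) x := by
  simp only [weissDensity, truncWeight_smul, norm_smul, Real.norm_eq_abs, mul_pow, sq_abs]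
  ring

lemma weissResidual_smul (m s r : ℝ) (t : ℝ) (p x : E) :
    weissResidual m (s * r) (s ^ 2 * t, s • p) (s • x) = s ^ 8 * weissResidual m r (t, p) x := by
  simp only [weissResidual, weissDensity_smul, weissDensityDeriv, truncWeight_smul, radialDefect,
    norm_smul, Real.norm_eq_abs, mul_pow, sq_abs, real_inner_smul_left, real_inner_smul_right]
  ring

end Densities

section Integrals

variable {E : Type*} [NormedAddCommGroup E] [InnerProductSpace ℝ E] [FiniteDimensional ℝ E]
  [MeasurableSpace E] [BorelSpace E]

lemma continuous_integrable_of_eq_zero {g : E → ℝ} (hg : Continuous g) {R : ℝ}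
    (h0 : ∀ x, R ≤ ‖x‖ → g x = 0) : Integrable g := by
  refine hg.integrable_of_hasCompactSupport
    (HasCompactSupport.intro (isCompact_closedBall (0 : E) R) fun x hx => h0 x ?_)
  simpa using (le_of_not_ge (by simpa using hx))

/-- Dominated convergence for integrands that depend continuously on a bounded parameter function
and are supported in a fixed ball. -/
lemma tendsto_integral_of_bounded_parameter {F : Type*} [NormedAddCommGroup F] [ProperSpace F]
    {Φ : F × E → ℝ} (hΦ : Continuous Φ) {R : ℝ} (hR : ∀ p x, R ≤ ‖x‖ → Φ (p, x) = 0)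
    {f : ℕ → E → F} (hf : ∀ n, Continuous (f n)) {q : ℕ → E → ℝ} (hq : ∀ n, Continuous (q n))
    {C : ℝ} (hfC : ∀ᶠ n in atTop, ∀ x, ‖x‖ ≤ R → ‖f n x‖ ≤ C)
    (hqC : ∀ᶠ n in atTop, ∀ x, ‖x‖ ≤ R → |q n x| ≤ 1)
    {h : E → ℝ} (hlim : ∀ x, ‖x‖ ≤ R → Tendsto (fun n => Φ (f n x, x) * q n x) atTop (𝓝 (h x)))
    (hh : ∀ x, R ≤ ‖x‖ → h x = 0) :
    Tendsto (fun n => ∫ x, Φ (f n x, x) * q n x) atTop (𝓝 (∫ x, h x)) := by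
  obtain ⟨B, hB⟩ := ((isCompact_closedBall (0 : F) C).prod
    (isCompact_closedBall (0 : E) R)).exists_bound_of_continuousOn hΦ.continuousOn
  refine tendsto_integral_filter_of_dominated_convergence
    ((closedBall (0 : E) R).indicator fun _ => B) ?_ ?_ ?_ ?_
  · refine Eventually.of_forall fun n => Continuous.aestronglyMeasurable ?_
    have := hf n
    have := hq n
    fun_prop
  · filter_upwards [hfC, hqC] with n hn hn'
    refine Eventually.of_forall fun x => ?_
    by_cases hx : ‖x‖ ≤ R
    · rw [indicator_of_mem (by simpa using hx), norm_mul]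
      have h1 := hB (f n x, x) ⟨by simpa using hn x hx, by simpa using hx⟩
      calc ‖Φ (f n x, x)‖ * ‖q n x‖ ≤ ‖Φ (f n x, x)‖ * 1 := by
            gcongr
            exact hn' x hx
        _ ≤ B := by simpa using h1
    · rw [indicator_of_notMem (by simpa using hx), hR _ _ (le_of_not_ge hx)]
      simp
  · exact (integrable_indicator_iff measurableSet_closedBall).2
      (integrableOn_const (isCompact_closedBall _ _).measure_lt_top.ne)
  · refine Eventually.of_forall fun x => ?_
    by_cases hx : ‖x‖ ≤ R
    · exact hlim x hx
    · have hx' := le_of_not_ge hx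
      simp [hR _ _ hx', hh x hx']

/-- The smoothed Weiss functional. -/
def weissEnergy (q : E → ℝ × E) (r : ℝ) : ℝ := ∫ x, weissDensity r (q x) x

lemma hasDerivAt_weissEnergy {q : E → ℝ × E} (hq : Continuous q) {r : ℝ} (hr : 0 < r) :
    HasDerivAt (weissEnergy q) (∫ x, weissDensityDeriv r (q x) x) r := by
  have hc : Continuous fun z : ℝ × E => weissDensityDeriv z.1 (q z.2) z.2 :=
    continuous_weissDensityDeriv.comp (f := fun z : ℝ × E => (z.1, q z.2, z.2)) (by fun_prop)
  have hc0 : ∀ s, Continuous fun x : E => weissDensity s (q x) x := fun s =>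
    continuous_weissDensity.comp (f := fun x : E => (s, q x, x)) (by fun_prop)
  obtain ⟨B, hB⟩ := ((isCompact_Icc (a := (0 : ℝ)) (b := r + 1)).prod
    (isCompact_closedBall (0 : E) (r + 1))).exists_bound_of_continuousOn hc.continuousOn
  refine (hasDerivAt_integral_of_dominated_loc_of_deriv_le
    (bound := (closedBall (0 : E) (r + 1)).indicator fun _ => B)
    (Ioo_mem_nhds hr (lt_add_one r))
    (Eventually.of_forall fun s => (hc0 s).aestronglyMeasurable)
    (continuous_integrable_of_eq_zero (hc0 r) fun x hx => weissDensity_eq_zero hr.le _ hx)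
    (hc.comp (f := fun x : E => (r, x)) (by fun_prop)).aestronglyMeasurable
    (Eventually.of_forall fun x s hs => ?_)
    ((integrable_indicator_iff measurableSet_closedBall).2
      (integrableOn_const (isCompact_closedBall _ _).measure_lt_top.ne))
    (Eventually.of_forall fun x s _ => hasDerivAt_weissDensity s (q x) x)).2
  by_cases hx : ‖x‖ ≤ r + 1
  · rw [indicator_of_mem (by simpa using hx)]
    exact hB (s, x) ⟨⟨hs.1.le, hs.2.le⟩, by simpa using hx⟩
  · rw [indicator_of_notMem (by simpa using hx),
      weissDensityDeriv_eq_zero hs.1.le _ (hs.2.le.trans (le_of_not_ge hx)), norm_zero]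

lemma hasDerivAt_weissEnergy_normalized {q : E → ℝ × E} (hq : Continuous q) (m : ℕ) {r : ℝ}
    (hr : 0 < r) (hres : ∫ x, weissResidual m r (q x) x = 0) :
    HasDerivAt (fun s => weissEnergy q s / s ^ m)
      ((∫ x, 12 * truncWeight r x ^ 2 * radialDefect (q x) x ^ 2) / r ^ (m + 1)) r := by
  have h := (hasDerivAt_weissEnergy hq hr).div (hasDerivAt_pow m r) (pow_pos hr m).ne'
  refine h.congr_deriv ?_
  have hcw : Continuous fun x : E => truncWeight r x :=
    continuous_truncWeight.comp (f := fun x : E => (r, x)) (by fun_prop)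
  have hcd : Continuous fun x : E => radialDefect (q x) x :=
    continuous_radialDefect.comp (f := fun x : E => (q x, x)) (by fun_prop)
  have i1 : Integrable fun x : E => weissDensity r (q x) x :=
    continuous_integrable_of_eq_zero
      (continuous_weissDensity.comp (f := fun x : E => (r, q x, x)) (by fun_prop))
      fun x hx => weissDensity_eq_zero hr.le _ hx
  have i2 : Integrable fun x : E => weissDensityDeriv r (q x) x :=
    continuous_integrable_of_eq_zero
      (continuous_weissDensityDeriv.comp (f := fun x : E => (r, q x, x)) (by fun_prop))
      fun x hx => weissDensityDeriv_eq_zero hr.le _ hx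
  have i3 : Integrable fun x : E => 12 * truncWeight r x ^ 2 * radialDefect (q x) x ^ 2 :=
    continuous_integrable_of_eq_zero (R := r) (by fun_prop)
      fun x hx => by simp [truncWeight_eq_zero hr.le hx]
  have i12 : Integrable fun x : E =>
      m * weissDensity r (q x) x - r * weissDensityDeriv r (q x) x :=
    (i1.const_mul _).sub (i2.const_mul _)
  have key : m * weissEnergy q r - r * (∫ x, weissDensityDeriv r (q x) x) +
      ∫ x, 12 * truncWeight r x ^ 2 * radialDefect (q x) x ^ 2 = 0 := by
    rw [← hres, weissEnergy, ← integral_const_mul, ← integral_const_mul,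
      ← integral_sub (i1.const_mul _) (i2.const_mul _),
      ← integral_add i12 i3]
    rfl
  rw [div_eq_div_iff (by positivity) (by positivity)]
  rw [← eq_neg_iff_add_eq_zero] at key
  have h3 : ∫ x, 12 * truncWeight r x ^ 2 * radialDefect (q x) x ^ 2 =
    r * (∫ x, weissDensityDeriv r (q x) x) - m * weissEnergy q r := by linarith
  rw [h3]
  rcases m with _ | m
  · simp; ring
  · simp only [Nat.add_sub_cancel]; ring

lemma weissEnergy_normalized_monotoneOn {q : E → ℝ × E} (hq : Continuous q) (m : ℕ) {R : ℝ}
    (hres : ∀ r, 0 < r → r < R → ∫ x, weissResidual m r (q x) x = 0) :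
    MonotoneOn (fun s => weissEnergy q s / s ^ m) (Ioo 0 R) := by
  have hd : ∀ r ∈ Ioo 0 R, HasDerivAt (fun s => weissEnergy q s / s ^ m)
      ((∫ x, 12 * truncWeight r x ^ 2 * radialDefect (q x) x ^ 2) / r ^ (m + 1)) r :=
    fun r hr => hasDerivAt_weissEnergy_normalized hq m hr.1 (hres r hr.1 hr.2)
  refine monotoneOn_of_deriv_nonneg (convex_Ioo 0 R)
    (fun r hr => (hd r hr).continuousAt.continuousWithinAt)
    (fun r hr => (hd r (interior_subset hr)).differentiableAt.differentiableWithinAt)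
    fun r hr => ?_
  have hr' := interior_subset hr
  rw [(hd r hr').deriv]
  have := hr'.1
  exact div_nonneg (integral_nonneg fun x => by positivity) (by positivity)

lemma radialDefect_eq_zero_of_integral_eq_zero {q : E → ℝ × E} (hq : Continuous q) {r : ℝ}
    (hr : 0 < r) (h : ∫ x, 12 * truncWeight r x ^ 2 * radialDefect (q x) x ^ 2 = 0) {x : E}
    (hx : ‖x‖ < r) : radialDefect (q x) x = 0 := by
  have hcw : Continuous fun x : E => truncWeight r x :=
    continuous_truncWeight.comp (f := fun x : E => (r, x)) (by fun_prop)
  have hcd : Continuous fun x : E => radialDefect (q x) x :=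
    continuous_radialDefect.comp (f := fun x : E => (q x, x)) (by fun_prop)
  have hc : Continuous fun x : E => 12 * truncWeight r x ^ 2 * radialDefect (q x) x ^ 2 := by
    fun_prop
  have hi := continuous_integrable_of_eq_zero hc (R := r)
      fun x hx => by simp [truncWeight_eq_zero hr.le hx]
  rw [integral_eq_zero_iff_of_nonneg (fun x => by positivity) hi,
    hc.ae_eq_iff_eq volume continuous_zero] at h
  have h0 := congrFun h x
  have := truncWeight_pos hx
  simpa [this.ne'] using h0

lemma integral_eq_of_comp_smul {g h : E → ℝ} {s c : ℝ} (hs : 0 < s)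
    (hgh : ∀ x, g (s • x) = c * h x) :
    ∫ x, g x = s ^ Module.finrank ℝ E * c * ∫ x, h x := by
  have h1 := Measure.integral_comp_smul_of_nonneg (volume : Measure E) g s (hR := hs.le)
  simp only [hgh, integral_const_mul, smul_eq_mul] at h1
  have : s ^ Module.finrank ℝ E ≠ 0 := (pow_pos hs _).ne'
  rw [mul_assoc, h1]
  field_simp

end Integrals

section SmoothIdentity

variable {N : ℕ}

lemma integral_fderiv_eq_zero {E : Type*} [NormedAddCommGroup E] [NormedSpace ℝ E]
    [FiniteDimensional ℝ E] [MeasurableSpace E] [BorelSpace E] (μ : Measure E)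
    [μ.IsAddHaarMeasure] {f : E → ℝ} (hf : ContDiff ℝ 1 f)
    (hc : HasCompactSupport f) (e : E) : ∫ x, fderiv ℝ f x e ∂μ = 0 := by
  have hi : Integrable (fun x => fderiv ℝ f x e) μ :=
    ((hf.continuous_fderiv one_ne_zero).clm_apply continuous_const).integrable_of_hasCompactSupport
      (hc.fderiv_apply (𝕜 := ℝ) e)
  have h := integral_mul_fderiv_eq_neg_fderiv_mul_of_integrable (μ := μ) (𝕜 := ℝ)
    (f := fun _ : E => (1 : ℝ)) (g := f) (v := e) (by simp) (by simpa using hi)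
    (by simpa using hf.continuous.integrable_of_hasCompactSupport hc) (by fun_prop)
    (fun x _ => hf.differentiable one_ne_zero x)
  simpa using h

lemma contDiff_truncWeight_pow {E : Type*} [NormedAddCommGroup E] [InnerProductSpace ℝ E]
    (r : ℝ) (n : ℕ) : ContDiff ℝ 1 fun x : E => truncWeight r x ^ (n + 2) := by
  have h1 : ContDiff ℝ 1 fun s : ℝ => max s 0 ^ (n + 2) := by
    rw [contDiff_one_iff_deriv]
    refine ⟨fun t => (hasDerivAt_max_zero_pow n t).differentiableAt, ?_⟩
    rw [funext fun t => (hasDerivAt_max_zero_pow n t).deriv]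
    fun_prop
  exact h1.comp (contDiff_const.sub (contDiff_norm_sq ℝ))

lemma hasDerivAt_truncWeight_line {E : Type*} [NormedAddCommGroup E] [InnerProductSpace ℝ E]
    (r : ℝ) (n : ℕ) (x e : E) :
    HasDerivAt (fun t : ℝ => truncWeight r (x + t • e) ^ (n + 2))
      (-(2 * (n + 2)) * truncWeight r x ^ (n + 1) * ⟪x, e⟫) 0 := by
  have h0 : HasDerivAt (fun t : ℝ => x + t • e) e 0 := by
    simpa using ((hasDerivAt_id (0 : ℝ)).smul_const e).const_add x
  have h1 := h0.norm_sq.const_sub (r ^ 2)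
  have h2 := hasDerivAt_max_zero_pow n (r ^ 2 - ‖x + (0 : ℝ) • e‖ ^ 2)
  refine (h2.comp (0 : ℝ) h1).congr_deriv ?_
  simp only [zero_smul, add_zero, truncWeight]
  ring

lemma gradient_apply_eq_fderiv (v : EuclideanSpace ℝ (Fin N) → ℝ) (x : EuclideanSpace ℝ (Fin N))
    (i : Fin N) : gradient v x i = fderiv ℝ v x (EuclideanSpace.single i 1) := by
  have : ⟪gradient v x, EuclideanSpace.single i 1⟫ =
      fderiv ℝ v x (EuclideanSpace.single i 1) := by
    simp only [gradient, InnerProductSpace.toDual_symm_apply]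
  rw [← this, EuclideanSpace.inner_single_right]
  simp

/-- The Weiss identity for a twice differentiable function that need not solve any equation. -/
theorem integral_weissResidual_of_contDiff {v : EuclideanSpace ℝ (Fin N) → ℝ}
    (hv : ContDiff ℝ 2 v) {r : ℝ} (hr : 0 < r) :
    ∫ x, (weissResidual (N + 8) r (v x, gradient v x) x +
      2 * truncWeight r x ^ 3 * radialDefect (v x, gradient v x) x * (1 - lap N v x)) = 0 := by
  set e : Fin N → EuclideanSpace ℝ (Fin N) := fun i => EuclideanSpace.single i 1 with he
  set d : Fin N → EuclideanSpace ℝ (Fin N) → ℝ := fun i x => fderiv ℝ v x (e i) with hd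
  have hd1 : ∀ i, ContDiff ℝ 1 (d i) := fun i =>
    (hv.fderiv_right (m := 1) (by norm_num)).clm_apply contDiff_const
  have hx1 : ∀ i, ContDiff ℝ 1 fun x : EuclideanSpace ℝ (Fin N) => x i := fun i => by fun_prop
  have hv1 : ContDiff ℝ 1 v := hv.of_le (by norm_num)
  have ha2 : ContDiff ℝ 1 fun x : EuclideanSpace ℝ (Fin N) => truncWeight r x ^ 2 :=
    contDiff_truncWeight_pow r 0
  have ha3 : ContDiff ℝ 1 fun x : EuclideanSpace ℝ (Fin N) => truncWeight r x ^ 3 :=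
    contDiff_truncWeight_pow r 1
  set Z : Fin N → EuclideanSpace ℝ (Fin N) → ℝ := fun i x =>
    (∑ j, d j x ^ 2 + 2 * v x) * x i * truncWeight r x ^ 3
      - 2 * (∑ j, x j * d j x - 2 * v x) * d i x * truncWeight r x ^ 3
      - 12 * (v x ^ 2 * x i) * truncWeight r x ^ 2 with hZ
  have hZ1 : ∀ i, ContDiff ℝ 1 (Z i) := fun i => by
    simp only [hZ]
    fun_prop
  have hZ0 : ∀ i x, r ≤ ‖x‖ → Z i x = 0 := fun i x hx => by
    simp [hZ, truncWeight_eq_zero hr.le hx]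
  have hZc : ∀ i, HasCompactSupport (Z i) := fun i =>
    HasCompactSupport.intro (isCompact_closedBall 0 r) fun x hx => hZ0 i x
      (le_of_not_ge (by simpa using hx))
  have hsum : ∫ x, ∑ i, fderiv ℝ (Z i) x (e i) = 0 := by
    rw [integral_finsetSum _ fun i _ => ?_]
    · exact Finset.sum_eq_zero fun i _ => integral_fderiv_eq_zero volume (hZ1 i) (hZc i) (e i)
    · exact (((hZ1 i).continuous_fderiv one_ne_zero).clm_apply
        continuous_const).integrable_of_hasCompactSupport ((hZc i).fderiv_apply (𝕜 := ℝ) (e i))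
  rw [← hsum]
  congr 1
  funext x
  have hline : ∀ (f : EuclideanSpace ℝ (Fin N) → ℝ), ContDiff ℝ 1 f → ∀ i,
      HasDerivAt (fun t : ℝ => f (x + t • e i)) (fderiv ℝ f x (e i)) 0 := fun f hf i =>
    ((hf.differentiable one_ne_zero x).hasFDerivAt).hasLineDerivAt (e i)
  have hxe : ∀ i, ⟪x, e i⟫ = x i := fun i => by simp [he, EuclideanSpace.inner_single_right]
  have hxj : ∀ i j, HasDerivAt (fun t : ℝ => (x + t • e i) j) (if j = i then 1 else 0) 0 := by
    intro i j
    have := ((hasDerivAt_id (0 : ℝ)).smul_const (if j = i then (1 : ℝ) else 0)).const_add (x j)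
    simpa [he, Pi.single_apply, PiLp.single_apply] using this
  set D : Fin N → Fin N → ℝ := fun i j => fderiv ℝ (d j) x (e i) with hD
  have hsymm : ∀ i j, D i j = D j i := by
    intro i j
    have h2 : ∀ j, D i j = fderiv ℝ (fderiv ℝ v) x (e i) (e j) ∧
        D j i = fderiv ℝ (fderiv ℝ v) x (e j) (e i) := by
      have hdf : DifferentiableAt ℝ (fderiv ℝ v) x :=
        (hv.fderiv_right (m := 1) (by norm_num)).differentiable one_ne_zero x
      intro j
      simp only [hD, hd]
      rw [fderiv_clm_apply hdf (differentiableAt_const _),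
        fderiv_clm_apply hdf (differentiableAt_const _)]
      simp
    rw [(h2 j).1, (h2 j).2]
    exact (hv.contDiffAt.isSymmSndFDerivAt (by simp)) (e i) (e j)
  set a := truncWeight r x with ha
  set S := ∑ j, d j x ^ 2 with hS
  set T := ∑ j, x j * d j x with hT
  have hdiv : ∀ i, fderiv ℝ (Z i) x (e i) =
      (2 * ∑ j, d j x * D i j + 2 * d i x) * x i * a ^ 3 + (S + 2 * v x) * a ^ 3
        - 6 * (S + 2 * v x) * x i ^ 2 * a ^ 2
        - 2 * (d i x + ∑ j, x j * D i j - 2 * d i x) * d i x * a ^ 3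
        - 2 * (T - 2 * v x) * D i i * a ^ 3
        + 12 * (T - 2 * v x) * d i x * x i * a ^ 2
        - 24 * v x * d i x * x i * a ^ 2 - 12 * v x ^ 2 * a ^ 2
        + 48 * v x ^ 2 * x i ^ 2 * a := by
    intro i
    refine (hline (Z i) (hZ1 i) i).unique ?_
    have q1 : HasDerivAt (fun t : ℝ => ∑ j, d j (x + t • e i) ^ 2)
        (2 * ∑ j, d j x * D i j) 0 := by
      refine (HasDerivAt.fun_sum fun j _ => (hline (d j) (hd1 j) i).pow 2).congr_deriv ?_
      rw [Finset.mul_sum]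
      refine Finset.sum_congr rfl fun j _ => ?_
      simp [hD]
      ring
    have q2 : HasDerivAt (fun t : ℝ => ∑ j, (x + t • e i) j * d j (x + t • e i))
        (d i x + ∑ j, x j * D i j) 0 := by
      refine (HasDerivAt.fun_sum fun j _ => (hxj i j).mul (hline (d j) (hd1 j) i)).congr_deriv ?_
      simp [Finset.sum_add_distrib, hD]
    have q3 := hline v hv1 i
    have q4 := hline (d i) (hd1 i) i
    have q5 := hxj i i
    have q6 := hasDerivAt_truncWeight_line r 0 x (e i)
    have q7 := hasDerivAt_truncWeight_line r 1 x (e i)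
    have h := ((((q1.add (q3.const_mul 2)).mul q5).mul q7).sub
      ((((q2.sub (q3.const_mul 2)).const_mul 2).mul q4).mul q7)).sub
      ((((q3.pow 2).mul q5).const_mul 12).mul q6)
    refine h.congr_deriv ?_
    simp only [hxe, zero_smul, add_zero, Pi.add_apply, Pi.mul_apply, Pi.sub_apply, Pi.pow_apply,
      if_true, hD, ← ha, ← hS, ← hT]
    push_cast
    simp only [hd]
    ring
  have hlap : lap N v x = ∑ i, D i i := rfl
  have hgS : ‖gradient v x‖ ^ 2 = S := by
    rw [EuclideanSpace.norm_sq_eq]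
    simp only [gradient_apply_eq_fderiv, Real.norm_eq_abs, sq_abs]
    rfl
  have hgT : ⟪gradient v x, x⟫ = T := by
    rw [PiLp.inner_apply]
    simp only [gradient_apply_eq_fderiv]
    rfl
  have hxx : ‖x‖ ^ 2 = ∑ i, x i ^ 2 := by
    rw [EuclideanSpace.norm_sq_eq]
    simp
  have hna := norm_sq_mul_truncWeight r x
  rw [hxx, ← ha] at hna
  have hcross : ∑ i, (∑ j, d j x * D i j) * x i = ∑ i, (∑ j, x j * D i j) * d i x := by
    simp only [Finset.sum_mul]
    rw [Finset.sum_comm]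
    refine Finset.sum_congr rfl fun i _ => Finset.sum_congr rfl fun j _ => ?_
    rw [hsymm]
    ring
  have htotal : ∑ i, fderiv ℝ (Z i) x (e i) =
      2 * a ^ 3 * ∑ i, (∑ j, d j x * D i j) * x i + 2 * a ^ 3 * T
        + N * (S + 2 * v x) * a ^ 3 - 6 * (S + 2 * v x) * a ^ 2 * ∑ i, x i ^ 2
        + 2 * a ^ 3 * S - 2 * a ^ 3 * ∑ i, (∑ j, x j * D i j) * d i x
        - 2 * (T - 2 * v x) * a ^ 3 * ∑ i, D i i
        + 12 * (T - 2 * v x) * a ^ 2 * T - 24 * v x * a ^ 2 * T - N * 12 * v x ^ 2 * a ^ 2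
        + 48 * v x ^ 2 * a * ∑ i, x i ^ 2 := by
    have hrw : ∀ i, fderiv ℝ (Z i) x (e i) =
        2 * a ^ 3 * ((∑ j, d j x * D i j) * x i)
          + (2 * a ^ 3 + 12 * (T - 2 * v x) * a ^ 2 - 24 * v x * a ^ 2) * (x i * d i x)
          + ((S + 2 * v x) * a ^ 3 - 12 * v x ^ 2 * a ^ 2)
          + (-6 * (S + 2 * v x) * a ^ 2 + 48 * v x ^ 2 * a) * x i ^ 2
          + 2 * a ^ 3 * d i x ^ 2 - 2 * a ^ 3 * ((∑ j, x j * D i j) * d i x)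
          - 2 * (T - 2 * v x) * a ^ 3 * D i i := fun i => by
      rw [hdiv]; ring
    simp only [hrw, Finset.sum_add_distrib, Finset.sum_sub_distrib, ← Finset.mul_sum, ← hS, ← hT,
      Finset.sum_const, Finset.card_univ, Fintype.card_fin, nsmul_eq_mul]
    ring
  rw [htotal, hcross, hlap]
  simp only [weissResidual, weissDensity, weissDensityDeriv, radialDefect, hgS, hgT, ← ha]
  linear_combination (6 * (S + 2 * v x) * a - 48 * v x ^ 2) * hna

end SmoothIdentity

section Mollification

open scoped Convolution

lemma norm_gradient {E : Type*} [NormedAddCommGroup E] [InnerProductSpace ℝ E] [CompleteSpace E]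
    (f : E → ℝ) (x : E) : ‖gradient f x‖ = ‖fderiv ℝ f x‖ := by
  simp [gradient]

lemma continuous_gradient {E : Type*} [NormedAddCommGroup E] [InnerProductSpace ℝ E]
    [CompleteSpace E] {f : E → ℝ} (hf : ContDiff ℝ 1 f) : Continuous (gradient f) :=
  (InnerProductSpace.toDual ℝ E).symm.continuous.comp (hf.continuous_fderiv one_ne_zero)

lemma norm_normed_convolution_le {E G : Type*} [NormedAddCommGroup E] [NormedSpace ℝ E]
    [FiniteDimensional ℝ E] [MeasurableSpace E] [BorelSpace E] (μ : Measure E)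
    [μ.IsAddHaarMeasure] [NormedAddCommGroup G] [NormedSpace ℝ G]
    (φ : ContDiffBump (0 : E)) {g : E → G} {C : ℝ} (hC : ∀ x, ‖g x‖ ≤ C) (x : E) :
    ‖(φ.normed μ ⋆[ContinuousLinearMap.lsmul ℝ ℝ, μ] g) x‖ ≤ C := by
  calc ‖(φ.normed μ ⋆[ContinuousLinearMap.lsmul ℝ ℝ, μ] g) x‖
      ≤ ∫ t, φ.normed μ t * C ∂μ := by
        refine norm_integral_le_of_norm_le (φ.integrable_normed.mul_const C)
          (Eventually.of_forall fun t => ?_)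
        rw [ContinuousLinearMap.lsmul_apply, norm_smul, Real.norm_of_nonneg (φ.nonneg_normed t)]
        exact mul_le_mul_of_nonneg_left (hC _) (φ.nonneg_normed t)
    _ = C := by rw [integral_mul_const, φ.integral_normed, one_mul]

lemma fderiv_convolution_left_apply {E : Type*} [NormedAddCommGroup E] [NormedSpace ℝ E]
    [FiniteDimensional ℝ E] [MeasurableSpace E] [BorelSpace E] (μ : Measure E)
    [μ.IsAddHaarMeasure] {f g : E → ℝ} (hf : ContDiff ℝ 1 f) (hc : HasCompactSupport f)
    (hg : Continuous g) (x e : E) :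
    fderiv ℝ (f ⋆[ContinuousLinearMap.lsmul ℝ ℝ, μ] g) x e =
      ((fun y => fderiv ℝ f y e) ⋆[ContinuousLinearMap.lsmul ℝ ℝ, μ] g) x := by
  have hgl : LocallyIntegrable g μ := hg.locallyIntegrable
  rw [(hc.hasFDerivAt_convolution_left _ hf hgl x).fderiv]
  have hi : ConvolutionExistsAt (fderiv ℝ f) g x
      ((ContinuousLinearMap.lsmul ℝ ℝ).precompL E : _ →L[ℝ] ℝ →L[ℝ] _) μ :=
    (hc.fderiv ℝ).convolutionExists_left _ (hf.continuous_fderiv one_ne_zero) hgl x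
  rw [convolution_def, ContinuousLinearMap.integral_apply hi, convolution_def]
  rfl

lemma fderiv_convolution_right_eq {E : Type*} [NormedAddCommGroup E] [NormedSpace ℝ E]
    [FiniteDimensional ℝ E] [MeasurableSpace E] [BorelSpace E] (μ : Measure E)
    [μ.IsAddHaarMeasure] {f g : E → ℝ} (hf : Continuous f)
    (hg : ContDiff ℝ 1 g) (hc : HasCompactSupport g) (x : E) :
    fderiv ℝ (f ⋆[ContinuousLinearMap.lsmul ℝ ℝ, μ] g) x =
      (f ⋆[ContinuousLinearMap.lsmul ℝ ℝ, μ] fderiv ℝ g) x := by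
  rw [(hc.hasFDerivAt_convolution_right _ hf.locallyIntegrable hg x).fderiv]
  rfl

variable {N : ℕ}

lemma lap_convolution {f g : EuclideanSpace ℝ (Fin N) → ℝ} (hf : ContDiff ℝ 2 f)
    (hc : HasCompactSupport f) (hg : Continuous g) (x : EuclideanSpace ℝ (Fin N)) :
    lap N (f ⋆[ContinuousLinearMap.lsmul ℝ ℝ, volume] g) x =
      ∫ y, g y * lap N (fun z => f (x - z)) y := by
  have hf1 : ContDiff ℝ 1 f := hf.of_le (by norm_num)
  have hd1 : ∀ e, ContDiff ℝ 1 fun y => fderiv ℝ f y e := fun e =>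
    (hf.fderiv_right (m := 1) (by norm_num)).clm_apply contDiff_const
  have hcomp : ∀ (h : EuclideanSpace ℝ (Fin N) → ℝ), ContDiff ℝ 1 h → ∀ y e,
      fderiv ℝ (fun z => h (x - z)) y e = -fderiv ℝ h (x - y) e := by
    intro h hh y e
    have h1 := (hh.differentiable one_ne_zero (x - y)).hasFDerivAt.comp y
      ((hasFDerivAt_id y).const_sub x)
    have h2 : fderiv ℝ (fun z => h (x - z)) y = _ := h1.fderiv
    rw [h2]
    simp
  have hlap : ∀ y, lap N (fun z => f (x - z)) y = lap N f (x - y) := by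
    intro y
    unfold lap
    refine Finset.sum_congr rfl fun i _ => ?_
    simp only [hcomp f hf1]
    have := hcomp (fun z => fderiv ℝ f z (EuclideanSpace.single i 1)) (hd1 _) y
      (EuclideanSpace.single i 1)
    rw [fderiv_fun_neg, neg_apply, this, neg_neg]
  have hdc : ∀ e, HasCompactSupport fun y => fderiv ℝ f y e := fun e => hc.fderiv_apply (𝕜 := ℝ) e
  have hddc : ∀ e, HasCompactSupport fun y => fderiv ℝ (fun z => fderiv ℝ f z e) y e :=
    fun e => (hdc e).fderiv_apply (𝕜 := ℝ) e
  have hddcont : ∀ e, Continuous fun y => fderiv ℝ (fun z => fderiv ℝ f z e) y e := fun e =>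
    ((hd1 e).continuous_fderiv one_ne_zero).clm_apply continuous_const
  simp only [hlap]
  unfold lap
  simp only [Finset.mul_sum]
  rw [integral_finsetSum]
  · refine Finset.sum_congr rfl fun i _ => ?_
    simp only [fderiv_convolution_left_apply volume hf1 hc hg]
    rw [fderiv_convolution_left_apply volume (hd1 _) (hdc _) hg, convolution_eq_swap]
    simp only [ContinuousLinearMap.lsmul_apply, smul_eq_mul]
    exact integral_congr_ae (Eventually.of_forall fun y => mul_comm _ _)
  · intro i _
    refine Continuous.integrable_of_hasCompactSupport ?_ ?_
    · exact hg.mul ((hddcont _).comp (by fun_prop))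
    · have := (hddc (EuclideanSpace.single i 1)).comp_homeomorph (Homeomorph.subLeft x)
      exact this.mul_left

/-- Solutions can be approximated, locally in `C¹`, by smooth functions whose Laplacian lies
between `0` and `1` and is eventually equal to `1` at every point of `Ω`. -/
theorem exists_mollification {R : ℝ} {Ω : Set (EuclideanSpace ℝ (Fin N))} (hΩ : IsOpen Ω)
    {u : EuclideanSpace ℝ (Fin N) → ℝ} (hu : ContDiff ℝ 1 u)
    (hpde : ∀ φ : EuclideanSpace ℝ (Fin N) → ℝ, ContDiff ℝ (⊤ : ℕ∞) φ → tsupport φ ⊆ ball 0 R →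
      ∫ x, u x * lap N φ x = ∫ x in Ω, φ x) {r : ℝ} (hr : 0 < r) (hrR : r < R) :
    ∃ v : ℕ → EuclideanSpace ℝ (Fin N) → ℝ, ∃ C : ℝ, (∀ n, ContDiff ℝ 2 (v n)) ∧
      (∀ n x, ‖(v n x, gradient (v n) x)‖ ≤ C) ∧
      (∀ x, ‖x‖ ≤ r →
        Tendsto (fun n => (v n x, gradient (v n) x)) atTop (𝓝 (u x, gradient u x))) ∧
      (∀ n x, ‖x‖ ≤ r → 0 ≤ lap N (v n) x ∧ lap N (v n) x ≤ 1) ∧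
      ∀ x ∈ Ω, ‖x‖ ≤ r → ∀ᶠ n in atTop, lap N (v n) x = 1 := by
  set R' := (r + R) / 2 with hR'
  have hrR' : r < R' := by linarith
  have hR'R : R' < R := by linarith
  let η : ContDiffBump (0 : EuclideanSpace ℝ (Fin N)) := ⟨R', R, by linarith, hR'R⟩
  set w : EuclideanSpace ℝ (Fin N) → ℝ := fun x => η x * u x with hw
  have hw1 : ContDiff ℝ 1 w := η.contDiff.mul hu
  have hwc : HasCompactSupport w := η.hasCompactSupport.mul_right
  have hwu : ∀ x, ‖x‖ ≤ R' → w x = u x := fun x hx => by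
    have : η x = 1 := η.one_of_mem_closedBall (by simpa using hx)
    simp [hw, this]
  let φ : ℕ → ContDiffBump (0 : EuclideanSpace ℝ (Fin N)) := fun n =>
    ⟨(R' - r) / (n + 1) / 2, (R' - r) / (n + 1),
      div_pos (div_pos (by linarith) (by positivity)) two_pos,
      div_two_lt_of_pos (div_pos (by linarith) (by positivity))⟩
  have hφr : ∀ n, (φ n).rOut ≤ R' - r := fun n =>
    div_le_self (by linarith) (by linarith [n.cast_nonneg (α := ℝ)])
  have hφlim : Tendsto (fun n => (φ n).rOut) atTop (𝓝 0) :=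
    tendsto_const_nhds.div_atTop (tendsto_atTop_add_const_right _ _ tendsto_natCast_atTop_atTop)
  set v : ℕ → EuclideanSpace ℝ (Fin N) → ℝ := fun n =>
    (φ n).normed volume ⋆[ContinuousLinearMap.lsmul ℝ ℝ, volume] w with hv
  obtain ⟨C₁, hC₁⟩ := hw1.continuous.bounded_above_of_compact_support hwc
  obtain ⟨C₂, hC₂⟩ := (hw1.continuous_fderiv one_ne_zero).bounded_above_of_compact_support
    (hwc.fderiv ℝ)
  have hfd : ∀ n x, fderiv ℝ (v n) x =
      ((φ n).normed volume ⋆[ContinuousLinearMap.lsmul ℝ ℝ, volume] fderiv ℝ w) x := fun n x =>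
    fderiv_convolution_right_eq volume (φ n).continuous_normed hw1 hwc x
  have hsupp : ∀ n x, (tsupport fun z => (φ n).normed volume (x - z)) ⊆
      closedBall x (φ n).rOut := by
    intro n x
    refine closure_minimal (fun z hz => ?_) isClosed_closedBall
    have hz' : x - z ∈ Function.support ((φ n).normed volume) := hz
    rw [(φ n).support_normed_eq, mem_ball_zero_iff] at hz'
    rw [mem_closedBall, dist_comm, dist_eq_norm]
    exact hz'.le
  have hlap : ∀ n x, ‖x‖ ≤ r → lap N (v n) x = ∫ z in Ω, (φ n).normed volume (x - z) := by
    intro n x hx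
    have hsub : closedBall x (φ n).rOut ⊆ closedBall 0 R' := by
      refine closedBall_subset_closedBall' ?_
      rw [dist_zero_right]
      linarith [hφr n]
    rw [lap_convolution (φ n).contDiff_normed (φ n).hasCompactSupport_normed hw1.continuous,
      ← hpde (fun z => (φ n).normed volume (x - z))
        ((φ n).contDiff_normed.comp (contDiff_const.sub contDiff_id))
        (((hsupp n x).trans hsub).trans (closedBall_subset_ball hR'R))]
    refine integral_congr_ae (Eventually.of_forall fun z => ?_)
    by_cases hz : ‖z‖ ≤ R'
    · simp only [hwu z hz]
    · have hz0 : z ∉ tsupport fun z => (φ n).normed volume (x - z) := fun h =>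
        hz (by simpa using hsub (hsupp n x h))
      have hl0 : lap N (fun z => (φ n).normed volume (x - z)) z = 0 := by
        have h0 : (fun z => (φ n).normed volume (x - z)) =ᶠ[𝓝 z] fun _ => (0 : ℝ) :=
          notMem_tsupport_iff_eventuallyEq.1 hz0
        unfold lap
        refine Finset.sum_eq_zero fun i _ => ?_
        have h1 : (fun y => fderiv ℝ (fun z => (φ n).normed volume (x - z)) y
            (EuclideanSpace.single i 1)) =ᶠ[𝓝 z] fun _ => (0 : ℝ) := by
          filter_upwards [h0.fderiv (𝕜 := ℝ)] with y hy
          rw [hy]; simp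
        rw [h1.fderiv_eq]
        simp
      simp only [hl0, mul_zero]
  have hnorm_int : ∀ n x, Integrable fun z => (φ n).normed volume (x - z) := fun n x =>
    (φ n).integrable_normed.comp_sub_left x
  have hone : ∀ n x, ∫ z, (φ n).normed volume (x - z) = 1 := fun n x => by
    rw [integral_sub_left_eq_self (fun z => (φ n).normed volume z), (φ n).integral_normed]
  refine ⟨v, max C₁ C₂, fun n => ?_, fun n x => ?_, fun x hx => ?_, fun n x hx => ?_,
    fun x hxΩ hx => ?_⟩
  · exact (φ n).hasCompactSupport_normed.contDiff_convolution_left _ (φ n).contDiff_normed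
      hw1.continuous.locallyIntegrable
  · rw [Prod.norm_mk, norm_gradient, hfd]
    exact max_le_max (norm_normed_convolution_le _ _ hC₁ x) (norm_normed_convolution_le _ _ hC₂ x)
  · have hux : w =ᶠ[𝓝 x] u := by
      filter_upwards [isOpen_ball.mem_nhds (show x ∈ ball 0 R' by simpa using hx.trans_lt hrR')]
        with z hz
      exact hwu z (by simpa using (mem_ball_zero_iff.1 hz).le)
    refine Tendsto.prodMk_nhds ?_ ?_
    · rw [← hux.eq_of_nhds]
      exact ContDiffBump.convolution_tendsto_right_of_continuous hφlim hw1.continuous x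
    · have h := ContDiffBump.convolution_tendsto_right_of_continuous (μ := volume) hφlim
        (hw1.continuous_fderiv one_ne_zero) x
      rw [hux.fderiv_eq] at h
      have h2 := ((InnerProductSpace.toDual ℝ
        (EuclideanSpace ℝ (Fin N))).symm.continuous.tendsto _).comp h
      refine h2.congr fun n => ?_
      simp only [comp_apply, gradient, hfd]
  · rw [hlap n x hx, ← hone n x]
    exact ⟨integral_nonneg fun z => (φ n).nonneg_normed _,
      setIntegral_le_integral (hnorm_int n x) (Eventually.of_forall fun z => (φ n).nonneg_normed _)⟩
  · obtain ⟨ε, hε, hεΩ⟩ := Metric.isOpen_iff.1 hΩ x hxΩ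
    filter_upwards [hφlim.eventually_lt_const hε] with n hn
    rw [hlap n x hx, ← hone n x]
    refine setIntegral_eq_integral_of_forall_compl_eq_zero fun z hz => ?_
    by_contra hne
    exact hz (hεΩ ((closedBall_subset_ball hn) (hsupp n x (subset_tsupport _ hne))))

end Mollification

section BlowUp

variable {N : ℕ}

/-- Solutions satisfy the Weiss identity. -/
theorem integral_weissResidual_eq_zero {R : ℝ} {Ω : Set (EuclideanSpace ℝ (Fin N))}
    (hΩ : IsOpen Ω) {u : EuclideanSpace ℝ (Fin N) → ℝ} (hu : ContDiff ℝ 1 u)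
    (hpde : ∀ φ : EuclideanSpace ℝ (Fin N) → ℝ, ContDiff ℝ (⊤ : ℕ∞) φ → tsupport φ ⊆ ball 0 R →
      ∫ x, u x * lap N φ x = ∫ x in Ω, φ x)
    (hzero : ∀ x ∈ ball 0 R \ Ω, u x = 0 ∧ gradient u x = 0) {r : ℝ} (hr : 0 < r) (hrR : r < R) :
    ∫ x, weissResidual (N + 8) r (u x, gradient u x) x = 0 := by
  obtain ⟨v, C, hv, hC, hlim, hlap, hlapΩ⟩ := exists_mollification hΩ hu hpde hr hrR
  have hq : ∀ n, Continuous fun x => (v n x, gradient (v n) x) := fun n =>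
    (hv n).continuous.prodMk (continuous_gradient ((hv n).of_le (by norm_num)))
  have hlc : ∀ n, Continuous (lap N (v n)) := fun n => by
    unfold lap
    refine continuous_finsetSum _ fun i _ => ?_
    exact ((((hv n).fderiv_right (m := 1) (by norm_num)).clm_apply
      contDiff_const).continuous_fderiv one_ne_zero).clm_apply continuous_const
  set Φ : (ℝ × EuclideanSpace ℝ (Fin N)) × EuclideanSpace ℝ (Fin N) → ℝ :=
    fun z => weissResidual (N + 8) r z.1 z.2 with hΦ
  set Ψ : (ℝ × EuclideanSpace ℝ (Fin N)) × EuclideanSpace ℝ (Fin N) → ℝ :=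
    fun z => 2 * truncWeight r z.2 ^ 3 * radialDefect z.1 z.2 with hΨ
  have hΦc : Continuous Φ := (continuous_weissResidual (N + 8)).comp
    (f := fun z : (ℝ × EuclideanSpace ℝ (Fin N)) × EuclideanSpace ℝ (Fin N) => (r, z))
    (by fun_prop)
  have hΨc : Continuous Ψ := by
    have h1 : Continuous
        fun z : (ℝ × EuclideanSpace ℝ (Fin N)) × EuclideanSpace ℝ (Fin N) => truncWeight r z.2 :=
      continuous_truncWeight.comp
        (f := fun z : (ℝ × EuclideanSpace ℝ (Fin N)) × EuclideanSpace ℝ (Fin N) => (r, z.2))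
        (by fun_prop)
    have h2 := continuous_radialDefect (E := EuclideanSpace ℝ (Fin N))
    simp only [hΨ]
    fun_prop
  have hΦ0 : ∀ p x, r ≤ ‖x‖ → Φ (p, x) = 0 := fun p x hx => weissResidual_eq_zero _ hr.le p hx
  have hΨ0 : ∀ p x, r ≤ ‖x‖ → Ψ (p, x) = 0 := fun p x hx => by
    simp [hΨ, truncWeight_eq_zero hr.le hx]
  have hpair : ∀ x, ‖x‖ ≤ r → Tendsto (fun n => ((v n x, gradient (v n) x), x)) atTop
      (𝓝 ((u x, gradient u x), x)) := fun x hx => (hlim x hx).prodMk_nhds tendsto_const_nhds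
  have h1 : Tendsto (fun n => ∫ x, Φ ((v n x, gradient (v n) x), x) * 1) atTop
      (𝓝 (∫ x, Φ ((u x, gradient u x), x))) :=
    tendsto_integral_of_bounded_parameter hΦc hΦ0 hq (q := fun _ _ => 1)
      (fun n => continuous_const) (Eventually.of_forall fun n x _ => hC n x) (by simp)
      (fun x hx => by simpa [comp_def] using (hΦc.tendsto _).comp (hpair x hx))
      fun x hx => hΦ0 _ x hx
  have h2 : Tendsto (fun n => ∫ x, Ψ ((v n x, gradient (v n) x), x) * (1 - lap N (v n) x)) atTop
      (𝓝 (∫ _x : EuclideanSpace ℝ (Fin N), (0 : ℝ))) := by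
    refine tendsto_integral_of_bounded_parameter hΨc hΨ0 hq
      (fun n => continuous_const.sub (hlc n)) (Eventually.of_forall fun n x _ => hC n x)
      (Eventually.of_forall fun n x hx => ?_) (fun x hx => ?_) fun x hx => rfl
    · obtain ⟨h0, h1⟩ := hlap n x hx
      have : |1 - lap N (v n) x| ≤ 1 := abs_le.2 ⟨by linarith, by linarith⟩
      exact this
    · by_cases hxΩ : x ∈ Ω
      · refine tendsto_const_nhds.congr' ?_
        filter_upwards [hlapΩ x hxΩ hx] with n hn
        simp [hn]
      · have hz := hzero x ⟨by simpa using hx.trans_lt hrR, hxΩ⟩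
        have h := (hΨc.tendsto _).comp (hpair x hx)
        have hz0 : Ψ ((u x, gradient u x), x) = 0 := by simp [hΨ, radialDefect, hz.1, hz.2]
        rw [hz0] at h
        refine squeeze_zero_norm (fun n => ?_) (by simpa using h.norm)
        rw [norm_mul]
        obtain ⟨h0, h1⟩ := hlap n x hx
        have : |1 - lap N (v n) x| ≤ 1 := abs_le.2 ⟨by linarith, by linarith⟩
        exact mul_le_of_le_one_right (norm_nonneg _) this
  have hsum : ∀ n, (∫ x, Φ ((v n x, gradient (v n) x), x) * 1) +
      ∫ x, Ψ ((v n x, gradient (v n) x), x) * (1 - lap N (v n) x) = 0 := fun n => by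
    have := hq n
    have := hlc n
    rw [← integral_weissResidual_of_contDiff (hv n) hr, ← integral_add]
    · simp only [mul_one]; rfl
    · exact continuous_integrable_of_eq_zero (R := r) (by fun_prop) fun x hx => by
        rw [hΦ0 _ x hx, zero_mul]
    · exact continuous_integrable_of_eq_zero (R := r) (by fun_prop) fun x hx => by
        rw [hΨ0 _ x hx, zero_mul]
  have h3 := h1.add h2
  simp only [hsum, integral_zero, add_zero] at h3
  exact tendsto_nhds_unique h3 tendsto_const_nhds

lemma gradient_comp_smul {E : Type*} [NormedAddCommGroup E] [InnerProductSpace ℝ E]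
    [CompleteSpace E] {u : E → ℝ} (hu : ContDiff ℝ 1 u) (s c : ℝ) (x : E) :
    gradient (fun y => c * u (s • y)) x = (c * s) • gradient u (s • x) := by
  have h1 := (hu.differentiable one_ne_zero (s • x)).hasFDerivAt.comp x
    ((hasFDerivAt_id x).const_smul s)
  have h2 : fderiv ℝ (fun y => c * u (s • y)) x = _ := (h1.const_mul c).fderiv
  rw [gradient, h2, gradient, ← map_smul]
  congr 1
  ext y
  simp [mul_assoc]

/-- A `C¹` function with identically vanishing radial defect is homogeneous of degree two. -/
lemma homogeneous_of_radialDefect_eq_zero {E : Type*} [NormedAddCommGroup E]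
    [InnerProductSpace ℝ E] [CompleteSpace E] {u : E → ℝ} (hu : ContDiff ℝ 1 u)
    (h : ∀ x, radialDefect (u x, gradient u x) x = 0) {l : ℝ} (hl : 0 < l) (x : E) :
    u (l • x) = l ^ 2 * u x := by
  have hd : ∀ t ∈ Ioi (0 : ℝ), HasDerivAt (fun t : ℝ => u (t • x) / t ^ 2) 0 t := by
    intro t ht
    have ht' : t ≠ 0 := (mem_Ioi.1 ht).ne'
    have h0 : HasDerivAt (fun t : ℝ => t • x) x t := by
      simpa using (hasDerivAt_id t).smul_const x
    have h1 := (hu.differentiable one_ne_zero (t • x)).hasFDerivAt.comp_hasDerivAt t h0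
    refine (h1.div (hasDerivAt_pow 2 t) (pow_ne_zero 2 ht')).congr_deriv ?_
    have h2 := h (t • x)
    have h3 : ⟪gradient u (t • x), x⟫ = fderiv ℝ u (t • x) x := by
      simp only [gradient, InnerProductSpace.toDual_symm_apply]
    simp only [radialDefect, real_inner_smul_right, h3] at h2
    rw [div_eq_zero_iff]
    left
    simp only [comp_apply]
    push_cast
    linear_combination t * h2
  have hc := isOpen_Ioi.is_const_of_deriv_eq_zero isPreconnected_Ioi
    (fun t ht => (hd t ht).differentiableAt.differentiableWithinAt) (fun t ht => (hd t ht).deriv)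
    (mem_Ioi.2 hl) (mem_Ioi.2 one_pos)
  simp only [one_smul, one_pow, div_one] at hc
  rw [div_eq_iff (pow_pos hl 2).ne'] at hc
  rw [hc, mul_comm]

/-- If functions and their gradients converge locally uniformly, so do integrals of continuous
expressions in them that are supported in a fixed ball. -/
lemma tendsto_integral_of_tendstoUniformlyOn {E : Type*} [NormedAddCommGroup E]
    [InnerProductSpace ℝ E] [FiniteDimensional ℝ E] [MeasurableSpace E] [BorelSpace E]
    {Φ : (ℝ × E) × E → ℝ} (hΦ : Continuous Φ) {R : ℝ} (hR : ∀ p x, R ≤ ‖x‖ → Φ (p, x) = 0)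
    {v : ℕ → E → ℝ} {w : ℕ → E → E} (hv : ∀ n, Continuous (v n)) (hw : ∀ n, Continuous (w n))
    {v₀ : E → ℝ} {w₀ : E → E} (hv₀ : Continuous v₀) (hw₀ : Continuous w₀)
    (hvc : TendstoUniformlyOn v v₀ atTop (closedBall 0 R))
    (hwc : TendstoUniformlyOn w w₀ atTop (closedBall 0 R)) :
    Tendsto (fun n => ∫ x, Φ ((v n x, w n x), x)) atTop (𝓝 (∫ x, Φ ((v₀ x, w₀ x), x))) := by
  obtain ⟨A, hA⟩ := (isCompact_closedBall (0 : E) R).exists_bound_of_continuousOn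
    (hv₀.prodMk hw₀).continuousOn
  have hb : ∀ᶠ n in atTop, ∀ x, ‖x‖ ≤ R → ‖(v n x, w n x)‖ ≤ 1 + A := by
    filter_upwards [Metric.tendstoUniformlyOn_iff.1 hvc 1 one_pos,
      Metric.tendstoUniformlyOn_iff.1 hwc 1 one_pos] with n h1 h2 x hx
    have hx' : x ∈ closedBall (0 : E) R := by simpa using hx
    have h3 : ‖(v n x, w n x) - (v₀ x, w₀ x)‖ ≤ 1 := by
      rw [← dist_eq_norm, dist_comm, Prod.dist_eq]
      exact max_le (h1 x hx').le (h2 x hx').le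
    have h4 := norm_add_le ((v n x, w n x) - (v₀ x, w₀ x)) (v₀ x, w₀ x)
    rw [sub_add_cancel] at h4
    exact h4.trans (add_le_add h3 (hA x hx'))
  have h := tendsto_integral_of_bounded_parameter hΦ hR
    (fun n => (hv n).prodMk (hw n)) (q := fun _ _ => 1) (fun n => continuous_const) hb (by simp)
    (h := fun x => Φ ((v₀ x, w₀ x), x)) (fun x hx => ?_) fun x hx => hR _ x hx
  · simpa only [mul_one] using h
  · have hx' : x ∈ closedBall (0 : E) R := by simpa using hx
    have h1 := ((hvc.tendsto_at hx').prodMk_nhds (hwc.tendsto_at hx')).prodMk_nhds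
      (tendsto_const_nhds (x := x))
    simpa [comp_def] using (hΦ.tendsto _).comp h1

/-- If `F` is monotone near zero, then a pointwise limit of the rescalings `t ↦ F (r j * t)` with
`r j → 0` is constant. -/
lemma limit_eq_of_monotoneOn {F F₀ : ℝ → ℝ} {R : ℝ} (hR : 0 < R) (hF : MonotoneOn F (Ioo 0 R))
    {r : ℕ → ℝ} (hrpos : ∀ j, 0 < r j) (hrlim : Tendsto r atTop (𝓝 0))
    (hlim : ∀ t, 0 < t → Tendsto (fun j => F (r j * t)) atTop (𝓝 (F₀ t)))
    {s t : ℝ} (hs : 0 < s) (ht : 0 < t) : F₀ s = F₀ t := by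
  have hsmall : ∀ {t : ℝ}, 0 < t → ∀ {ε : ℝ}, 0 < ε → ∀ᶠ j in atTop, r j * t < ε := by
    intro t ht ε hε
    have : Tendsto (fun j => r j * t) atTop (𝓝 0) := by simpa using hrlim.mul_const t
    exact this.eventually_lt_const hε
  have hle : ∀ {s t : ℝ}, 0 < s → 0 < t → F₀ t ≤ F₀ s := by
    intro s t hs ht
    refine ge_of_tendsto (hlim s hs) ?_
    filter_upwards [hsmall hs hR] with j hj
    refine le_of_tendsto (hlim t ht) ?_
    have hp := mul_pos (hrpos j) hs
    filter_upwards [hsmall ht hp] with k hk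
    exact hF ⟨mul_pos (hrpos k) ht, hk.trans hj⟩ ⟨hp, hj⟩ hk.le
  exact le_antisymm (hle ht hs) (hle hs ht)

/-- A blow-up limit of a function satisfying the Weiss identity has no radial defect. -/
theorem radialDefect_blowup_eq_zero {E : Type*} [NormedAddCommGroup E]
    [InnerProductSpace ℝ E] [FiniteDimensional ℝ E] [MeasurableSpace E] [BorelSpace E]
    {u : E → ℝ} (hu : ContDiff ℝ 1 u) {R : ℝ} (hR : 0 < R) {m : ℕ}
    (hm : m = Module.finrank ℝ E + 8)
    (hres : ∀ ρ, 0 < ρ → ρ < R → ∫ x, weissResidual m ρ (u x, gradient u x) x = 0)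
    {r : ℕ → ℝ} (hrpos : ∀ j, 0 < r j) (hrlim : Tendsto r atTop (𝓝 0))
    {u₀ : E → ℝ} (hu₀ : ContDiff ℝ 1 u₀)
    (hconv : ∀ K : Set E, IsCompact K →
      TendstoUniformlyOn (fun j x => u (r j • x) / r j ^ 2) u₀ atTop K)
    (hgconv : ∀ K : Set E, IsCompact K →
      TendstoUniformlyOn (fun j x => gradient (fun y => u (r j • y) / r j ^ 2) x)
        (gradient u₀) atTop K) (x : E) :
    radialDefect (u₀ x, gradient u₀ x) x = 0 := by
  set v : ℕ → E → ℝ := fun j y => u (r j • y) / r j ^ 2 with hv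
  have hvC : ∀ j, ContDiff ℝ 1 (v j) := fun j => by
    simp only [hv]
    exact (hu.comp (contDiff_const_smul (r j))).div_const _
  have hvu : ∀ j y, u (r j • y) = r j ^ 2 * v j y := fun j y => by
    have := (hrpos j).ne'
    simp only [hv]; field_simp
  have hvg : ∀ j y, gradient u (r j • y) = r j • gradient (v j) y := fun j y => by
    have h : v j = fun y => (r j ^ 2)⁻¹ * u (r j • y) := by
      ext y; simp only [hv]; rw [div_eq_inv_mul]
    have hr := (hrpos j).ne'
    rw [h, gradient_comp_smul hu, smul_smul]
    have : r j * ((r j ^ 2)⁻¹ * r j) = 1 := by field_simp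
    rw [this, one_smul]
  have hcq : ∀ {w : E → ℝ}, ContDiff ℝ 1 w → Continuous fun x => (w x, gradient w x) :=
    fun hw => hw.continuous.prodMk (continuous_gradient hw)
  have hlim : ∀ Φ : ℝ × (ℝ × E) × E → ℝ, Continuous Φ → ∀ ρ : ℝ,
      (∀ p x, ρ ≤ ‖x‖ → Φ (ρ, p, x) = 0) →
      Tendsto (fun j => ∫ x, Φ (ρ, (v j x, gradient (v j) x), x)) atTop
        (𝓝 (∫ x, Φ (ρ, (u₀ x, gradient u₀ x), x))) := fun Φ hΦ ρ h0 =>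
    tendsto_integral_of_tendstoUniformlyOn (Φ := fun z => Φ (ρ, z)) (by fun_prop) h0
      (fun j => (hvC j).continuous) (fun j => continuous_gradient (hvC j)) hu₀.continuous
      (continuous_gradient hu₀) (hconv _ (isCompact_closedBall _ _))
      (hgconv _ (isCompact_closedBall _ _))
  have henergy : ∀ ρ : ℝ, 0 < ρ → Tendsto (fun j =>
      weissEnergy (fun x => (u x, gradient u x)) (r j * ρ) / (r j * ρ) ^ m) atTop
      (𝓝 (weissEnergy (fun x => (u₀ x, gradient u₀ x)) ρ / ρ ^ m)) := fun ρ hρ => by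
    refine ((hlim _ continuous_weissDensity ρ
      fun p x hx => weissDensity_eq_zero hρ.le p hx).div_const (ρ ^ m)).congr fun j => ?_
    have h := integral_eq_of_comp_smul (hrpos j)
      (g := fun x => weissDensity (r j * ρ) (u x, gradient u x) x) fun x => by
        rw [hvu, hvg, weissDensity_smul]
    have hr := (hrpos j).ne'
    rw [weissEnergy, h, ← pow_add, ← hm, mul_pow, mul_div_mul_left _ _ (pow_ne_zero m hr)]
  have hres₀ : ∀ ρ : ℝ, 0 < ρ → ∫ x, weissResidual m ρ (u₀ x, gradient u₀ x) x = 0 := by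
    intro ρ hρ
    refine tendsto_nhds_unique (hlim _ (continuous_weissResidual m) ρ
      fun p x hx => weissResidual_eq_zero _ hρ.le p hx) ?_
    refine tendsto_const_nhds.congr' ?_
    have hsm : Tendsto (fun j => r j * ρ) atTop (𝓝 0) := by simpa using hrlim.mul_const ρ
    filter_upwards [hsm.eventually_lt_const hR] with j hj
    have h := integral_eq_of_comp_smul (hrpos j)
      (g := fun x => weissResidual m (r j * ρ) (u x, gradient u x) x) fun x => by
        rw [hvu, hvg, weissResidual_smul]
    rw [hres _ (mul_pos (hrpos j) hρ) hj] at h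
    have hr := hrpos j
    exact ((mul_eq_zero.1 h.symm).resolve_left (by positivity)).symm
  have hρ : 0 < ‖x‖ + 1 := by positivity
  have hder := hasDerivAt_weissEnergy_normalized (hcq hu₀) m hρ (hres₀ _ hρ)
  have hconst := hder.unique ((hasDerivAt_const (‖x‖ + 1) (weissEnergy
      (fun x => (u₀ x, gradient u₀ x)) (‖x‖ + 1) / (‖x‖ + 1) ^ m)).congr_of_eventuallyEq (by
    filter_upwards [Ioi_mem_nhds hρ] with s hs
    exact limit_eq_of_monotoneOn hR (weissEnergy_normalized_monotoneOn (hcq hu) m hres) hrpos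
      hrlim (F₀ := fun s => weissEnergy (fun x => (u₀ x, gradient u₀ x)) s / s ^ m) henergy hs hρ))
  refine radialDefect_eq_zero_of_integral_eq_zero (hcq hu₀) hρ ?_ (lt_add_one ‖x‖)
  exact (div_eq_zero_iff.1 hconst).resolve_right (by positivity)

end BlowUp

end Weiss

/-- any blow-up of a solution at the origin is homogeneous of degree two,
and its zero set (together with the gradient) is a cone. -/
theorem blowup_homogeneous (N : ℕ) (hN : 2 ≤ N) (M : ℝ) (hM : 0 < M)
    (Ω : Set (EuclideanSpace ℝ (Fin N))) (u : EuclideanSpace ℝ (Fin N) → ℝ)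
    (hu : MemP N 1 0 M Ω u) (r : ℕ → ℝ) (hrpos : ∀ j, 0 < r j)
    (hrlim : Filter.Tendsto r Filter.atTop (nhds 0))
    (u₀ : EuclideanSpace ℝ (Fin N) → ℝ) (hu₀ : ContDiff ℝ 1 u₀)
    (hconv : ∀ K : Set (EuclideanSpace ℝ (Fin N)), IsCompact K →
      TendstoUniformlyOn (fun j x => u (r j • x) / r j ^ 2) u₀ Filter.atTop K)
    (hgconv : ∀ K : Set (EuclideanSpace ℝ (Fin N)), IsCompact K →
      TendstoUniformlyOn (fun j x => gradient (fun y => u (r j • y) / r j ^ 2) x)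
        (gradient u₀) Filter.atTop K) :
    (∀ l : ℝ, 0 < l → ∀ x, u₀ (l • x) = l ^ 2 * u₀ x) ∧
      (∀ l : ℝ, 0 < l → ∀ x, u₀ x = 0 ∧ gradient u₀ x = 0 →
        u₀ (l • x) = 0 ∧ gradient u₀ (l • x) = 0) := by
  obtain ⟨hΩ, hu1, hpde, hzero, -, -⟩ := hu
  have hdef := radialDefect_blowup_eq_zero hu1 one_pos (m := N + 8) (by simp)
    (fun ρ hρ hρ1 => by
      push_cast
      exact integral_weissResidual_eq_zero hΩ hu1 hpde hzero hρ hρ1)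
    hrpos hrlim hu₀ hconv hgconv
  have hhom : ∀ l : ℝ, 0 < l → ∀ x, u₀ (l • x) = l ^ 2 * u₀ x := fun l hl x =>
    homogeneous_of_radialDefect_eq_zero hu₀ hdef hl x
  refine ⟨hhom, fun l hl x hx => ⟨by rw [hhom l hl, hx.1, mul_zero], ?_⟩⟩
  have h1 := gradient_comp_smul hu₀ l 1 x
  have h2 := gradient_comp_smul hu₀ 1 (l ^ 2) x
  simp only [one_mul, one_smul, mul_one, hhom l hl, hx.2, smul_zero] at h1 h2
  exact (smul_eq_zero.1 (h1.symm.trans h2)).resolve_left hl.ne'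
end
end

section
/- There exists ε₀ > 0 depending only on N such that: if u ∈ P₁(0,M), C > 0, and C·D₁u(x) − u(x) ≥ −ε₀ for all x ∈ B(0,1) (where D₁u denotes the partial derivative of u in the first coordinate direction), then C·D₁u(x) − u(x) ≥ 0 for all x ∈ B(0,1/2). -/
open MeasureTheory Metric Set Filter
open scoped RealInnerProductSpace

noncomputable section

/-- At a local minimum of a `C²` function, each pure second derivative is nonnegative. -/
theorem IsLocalMin.fderiv_fderiv_apply_nonneg {E : Type*} [NormedAddCommGroup E]
    [NormedSpace ℝ E] {v : E → ℝ} {x : E} (hv : ContDiff ℝ 2 v) (hmin : IsLocalMin v x) (e : E) :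
    0 ≤ fderiv ℝ (fun y => fderiv ℝ v y e) x e := by
  have hline (t : ℝ) : HasDerivAt (fun s : ℝ => x + s • e) e t := by
    simpa using ((hasDerivAt_id t).smul_const e).const_add x
  have hd : deriv (fun t : ℝ => v (x + t • e)) = fun t => fderiv ℝ v (x + t • e) e := by
    ext t
    exact (((hv.differentiable (by norm_num)) _).hasFDerivAt.comp_hasDerivAt t (hline t)).deriv
  have hv' : ContDiff ℝ 1 (fun y => fderiv ℝ v y e) :=
    (hv.fderiv_right (m := 1) (by norm_num)).clm_apply contDiff_const
  have hdd : deriv (deriv (fun t : ℝ => v (x + t • e))) 0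
      = fderiv ℝ (fun y => fderiv ℝ v y e) x e := by
    rw [hd]
    have h := ((hv'.differentiable (by norm_num)) (x + (0 : ℝ) • e)).hasFDerivAt.comp_hasDerivAt
      (0 : ℝ) (hline 0)
    simpa [Function.comp_def] using h.deriv
  have hc : Continuous (fun t : ℝ => x + t • e) := by fun_prop
  have hmin0 : IsLocalMin (fun t : ℝ => v (x + t • e)) 0 := by
    have h : Tendsto (fun t : ℝ => x + t • e) (nhds 0) (nhds x) := by
      simpa using hc.tendsto 0
    simpa [IsLocalMin, IsMinFilter] using h.eventually hmin
  by_contra! hneg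
  have hmax : IsLocalMax (fun t : ℝ => v (x + t • e)) 0 :=
    isLocalMax_of_deriv_deriv_neg (by rwa [hdd]) hmin0.deriv_eq_zero
      (hv.continuous.comp hc).continuousAt
  have hconst : (fun t : ℝ => v (x + t • e)) =ᶠ[nhds 0] fun _ => v (x + (0 : ℝ) • e) := by
    filter_upwards [hmin0, hmax] with t h₁ h₂ using le_antisymm h₂ h₁
  have hzero := hconst.deriv.deriv.eq_of_nhds
  simp only [hdd, deriv_const', deriv_const] at hzero
  exact hneg.ne hzero

theorem contDiff_integral_mul_comp_sub {E : Type*} [NormedAddCommGroup E] [NormedSpace ℝ E]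
    [MeasurableSpace E] [BorelSpace E] {μ : Measure E} [IsLocallyFiniteMeasure μ]
    {u ψ : E → ℝ} (hu : Continuous u) (hc : HasCompactSupport ψ)
    {n : ℕ∞} (hψ : ContDiff ℝ n ψ) : ContDiff ℝ n (fun x => ∫ t, u t * ψ (x - t) ∂μ) :=
  hc.contDiff_convolution_right (ContinuousLinearMap.mul ℝ ℝ) hu.locallyIntegrable hψ

theorem integrable_mul_comp_sub {E : Type*} [NormedAddCommGroup E]
    [MeasurableSpace E] [BorelSpace E] {μ : Measure E} [IsLocallyFiniteMeasure μ]
    {u ψ : E → ℝ} (hu : Continuous u) (hc : HasCompactSupport ψ)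
    (hψ : Continuous ψ) (x : E) : Integrable (fun t => u t * ψ (x - t)) μ :=
  (hc.convolutionExists_right (ContinuousLinearMap.mul ℝ ℝ) hu.locallyIntegrable hψ) x

theorem fderiv_integral_mul_comp_sub {E : Type*} [NormedAddCommGroup E] [NormedSpace ℝ E] [FiniteDimensional ℝ E]
    [MeasurableSpace E] [BorelSpace E] {μ : Measure E} [IsLocallyFiniteMeasure μ] [μ.IsAddLeftInvariant]
    {u ψ : E → ℝ} (hu : Continuous u) (hc : HasCompactSupport ψ)
    (hψ : ContDiff ℝ 1 ψ) (x e : E) :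
    fderiv ℝ (fun x => ∫ t, u t * ψ (x - t) ∂μ) x e = ∫ t, u t * fderiv ℝ ψ (x - t) e ∂μ := by
  have h := (hc.hasFDerivAt_convolution_right (ContinuousLinearMap.mul ℝ ℝ)
    (hu.locallyIntegrable (μ := μ)) hψ x).fderiv
  have h' : fderiv ℝ (fun x => ∫ t, u t * ψ (x - t) ∂μ) x = _ := h
  rw [h', convolution_precompR_apply _ hu.locallyIntegrable (hc.fderiv (𝕜 := ℝ))
    (hψ.continuous_fderiv (by norm_num))]
  rfl

theorem fderiv_comp_const_sub_apply {E : Type*} [NormedAddCommGroup E] [NormedSpace ℝ E]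
    {ψ : E → ℝ} (hψ : Differentiable ℝ ψ) (x z e : E) :
    fderiv ℝ (fun z => ψ (x - z)) z e = -fderiv ℝ ψ (x - z) e := by
  have h := (hψ (x - z)).hasFDerivAt.comp z ((hasFDerivAt_id z).const_sub x)
  have h' : fderiv ℝ (fun z => ψ (x - z)) z = _ := h.fderiv
  simp [h']

theorem contDiff_fderiv_apply {E : Type*} [NormedAddCommGroup E] [NormedSpace ℝ E] {ψ : E → ℝ}
    (hψ : ContDiff ℝ (⊤ : ℕ∞) ψ) (e : E) : ContDiff ℝ (⊤ : ℕ∞) (fun y => fderiv ℝ ψ y e) :=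
  (hψ.fderiv_right (by simp)).clm_apply contDiff_const

/-- Integration by parts moves a directional derivative onto the mollifier. -/
theorem integral_fderiv_mul_comp_sub {N : ℕ} {u ρ : EuclideanSpace ℝ (Fin N) → ℝ}
    (hu : ContDiff ℝ 1 u) (hρ : ContDiff ℝ 1 ρ) (hc : HasCompactSupport ρ)
    (x e : EuclideanSpace ℝ (Fin N)) :
    ∫ t, fderiv ℝ u t e * ρ (x - t) = ∫ t, u t * fderiv ℝ ρ (x - t) e := by
  have hdu : Continuous fun t => fderiv ℝ u t e :=
    (hu.continuous_fderiv (by norm_num)).clm_apply continuous_const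
  have hdρ : Continuous fun t => fderiv ℝ ρ t e :=
    (hρ.continuous_fderiv (by norm_num)).clm_apply continuous_const
  have hρd := hρ.differentiable (by norm_num)
  have h := integral_mul_fderiv_eq_neg_fderiv_mul_of_integrable (μ := volume) (f := u)
    (g := fun t => ρ (x - t)) (v := e)
    (integrable_mul_comp_sub hdu hc hρ.continuous x)
    (by
      simp only [fderiv_comp_const_sub_apply hρd, mul_neg]
      exact (integrable_mul_comp_sub hu.continuous (hc.fderiv_apply (𝕜 := ℝ) e) hdρ x).neg)
    (integrable_mul_comp_sub hu.continuous hc hρ.continuous x)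
    (fun y _ => hu.differentiable (by norm_num) y)
    (fun y _ => (hρd.comp (differentiable_id.const_sub x)) y)
  simp only [fderiv_comp_const_sub_apply hρd, mul_neg, integral_neg, neg_inj] at h
  exact h.symm

theorem integral_fderiv_eq_zero_s13 {N : ℕ} {ρ : EuclideanSpace ℝ (Fin N) → ℝ}
    (hρ : ContDiff ℝ 1 ρ) (hc : HasCompactSupport ρ) (e : EuclideanSpace ℝ (Fin N)) :
    ∫ t, fderiv ℝ ρ t e = 0 := by
  have h := integral_fderiv_mul_comp_sub (u := fun _ => (1 : ℝ)) contDiff_const hρ hc 0 e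
  simp only [fderiv_fun_const, Pi.zero_apply, zero_apply, zero_mul,
    integral_zero, one_mul, zero_sub] at h
  rw [h, integral_neg_eq_self (fun t => fderiv ℝ ρ t e)]

section Laplacian

variable {N : ℕ}

theorem IsLocalMin.lap_nonneg {v : EuclideanSpace ℝ (Fin N) → ℝ} {x : EuclideanSpace ℝ (Fin N)}
    (hv : ContDiff ℝ 2 v) (hmin : IsLocalMin v x) : 0 ≤ lap N v x :=
  Finset.sum_nonneg fun _ _ => hmin.fderiv_fderiv_apply_nonneg hv _

theorem lap_comp_const_sub {ψ : EuclideanSpace ℝ (Fin N) → ℝ} (hψ : ContDiff ℝ (⊤ : ℕ∞) ψ)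
    (x z : EuclideanSpace ℝ (Fin N)) : lap N (fun z => ψ (x - z)) z = lap N ψ (x - z) := by
  refine Finset.sum_congr rfl fun i _ => ?_
  simp only [fderiv_comp_const_sub_apply (hψ.differentiable (by simp))]
  rw [fderiv_fun_neg, neg_apply,
    fderiv_comp_const_sub_apply ((contDiff_fderiv_apply hψ _).differentiable (by simp)), neg_neg]

theorem lap_add {f g : EuclideanSpace ℝ (Fin N) → ℝ} (hf : ContDiff ℝ (⊤ : ℕ∞) f)
    (hg : ContDiff ℝ (⊤ : ℕ∞) g) (x : EuclideanSpace ℝ (Fin N)) :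
    lap N (fun y => f y + g y) x = lap N f x + lap N g x := by
  unfold lap
  rw [← Finset.sum_add_distrib]
  refine Finset.sum_congr rfl fun i _ => ?_
  have h (y) := fderiv_fun_add (hf.differentiable (by simp) y) (hg.differentiable (by simp) y)
  simp only [h, add_apply]
  rw [fderiv_fun_add ((contDiff_fderiv_apply hf _).differentiable (by simp) x)
    ((contDiff_fderiv_apply hg _).differentiable (by simp) x), add_apply]

theorem lap_const_mul_norm_sub_sq (a : ℝ) (y x : EuclideanSpace ℝ (Fin N)) :
    lap N (fun z => a * ‖z - y‖ ^ 2) x = 2 * a * N := by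
  have h (z e : EuclideanSpace ℝ (Fin N)) :
      fderiv ℝ (fun z => a * ‖z - y‖ ^ 2) z e = 2 * a * ⟪z - y, e⟫ := by
    have h := (((hasFDerivAt_id z).sub_const y).norm_sq).const_mul a
    have h' : fderiv ℝ (fun z => a * ‖z - y‖ ^ 2) z = _ := h.fderiv
    simp [h', inner_sub_left]
    ring
  have h₂ (e : EuclideanSpace ℝ (Fin N)) :
      fderiv ℝ (fun z => 2 * a * ⟪z - y, e⟫) x e = 2 * a * ‖e‖ ^ 2 := by
    have h := ((((hasFDerivAt_id x).sub_const y).inner ℝ (hasFDerivAt_const e x))).const_mul (2 * a)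
    have h' : fderiv ℝ (fun z => 2 * a * ⟪z - y, e⟫) x = _ := h.fderiv
    rw [h']
    simp [fderivInnerCLM_apply]
  simp only [lap, h, h₂, PiLp.norm_single]
  simp
  ring

theorem lap_integral_mul_comp_sub {u ψ : EuclideanSpace ℝ (Fin N) → ℝ} (hu : Continuous u)
    (hc : HasCompactSupport ψ) (hψ : ContDiff ℝ (⊤ : ℕ∞) ψ) (x : EuclideanSpace ℝ (Fin N)) :
    lap N (fun x => ∫ t, u t * ψ (x - t)) x = ∫ t, u t * lap N ψ (x - t) := by
  have hψ1 : ContDiff ℝ 1 ψ := hψ.of_le (by simp)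
  simp only [lap, fderiv_integral_mul_comp_sub hu hc hψ1, Finset.mul_sum]
  rw [integral_finsetSum]
  · refine Finset.sum_congr rfl fun i _ => ?_
    exact fderiv_integral_mul_comp_sub hu (hc.fderiv_apply (𝕜 := ℝ) _)
      ((contDiff_fderiv_apply hψ _).of_le (by simp)) x _
  · intro i _
    exact integrable_mul_comp_sub hu ((hc.fderiv_apply (𝕜 := ℝ) _).fderiv_apply (𝕜 := ℝ) _)
      (contDiff_fderiv_apply (contDiff_fderiv_apply hψ _) _).continuous x

end Laplacian

/-- Mollifications of `C ∂ₑu - u` have Laplacian `-1` well inside `Ω`. -/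
theorem lap_mollified_eq_neg_one {N : ℕ} {r M : ℝ} {z x e : EuclideanSpace ℝ (Fin N)}
    {Ω : Set (EuclideanSpace ℝ (Fin N))} {u ρ : EuclideanSpace ℝ (Fin N) → ℝ} (C : ℝ) {δ : ℝ}
    (hu : MemP N r z M Ω u) (hρ : ContDiff ℝ (⊤ : ℕ∞) ρ) (hsupp : tsupport ρ ⊆ closedBall 0 δ)
    (hint : ∫ t, ρ t = 1) (hx : closedBall x δ ⊆ Ω ∩ ball z r) :
    lap N (fun x => ∫ t, (C * fderiv ℝ u t e - u t) * ρ (x - t)) x = -1 := by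
  obtain ⟨-, huC, hweak, -⟩ := hu
  have hc : HasCompactSupport ρ := (isCompact_closedBall 0 δ).of_isClosed_subset
    (isClosed_tsupport ρ) hsupp
  have hρ1 : ContDiff ℝ 1 ρ := hρ.of_le (by simp)
  have hdρ := contDiff_fderiv_apply hρ e
  have hcd : HasCompactSupport fun t => fderiv ℝ ρ t e := hc.fderiv_apply (𝕜 := ℝ) e
  have hdu : Continuous fun t => fderiv ℝ u t e :=
    (huC.continuous_fderiv (by norm_num)).clm_apply continuous_const
  set ψ : EuclideanSpace ℝ (Fin N) → ℝ := fun t => C * fderiv ℝ ρ t e - ρ t with hψdef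
  have hψ : ContDiff ℝ (⊤ : ℕ∞) ψ := (contDiff_const.mul hdρ).sub hρ
  have hψsupp : tsupport ψ ⊆ closedBall 0 δ := by
    refine closure_minimal (fun t ht => ?_) isClosed_closedBall
    by_contra hn
    have h₁ : ρ t = 0 := image_eq_zero_of_notMem_tsupport fun h => hn (hsupp h)
    have h₂ : fderiv ℝ ρ t = 0 :=
      image_eq_zero_of_notMem_tsupport fun h => hn (hsupp (tsupport_fderiv_subset ℝ h))
    simp [hψdef, h₁, h₂] at ht
  have hψc : HasCompactSupport ψ := (isCompact_closedBall 0 δ).of_isClosed_subset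
    (isClosed_tsupport ψ) hψsupp
  have hswap : (fun x => ∫ t, (C * fderiv ℝ u t e - u t) * ρ (x - t))
      = fun x => ∫ t, u t * ψ (x - t) := by
    ext x
    have i₁ := (integrable_mul_comp_sub (μ := volume) hdu hc hρ.continuous x).const_mul C
    have i₂ := integrable_mul_comp_sub (μ := volume) huC.continuous hc hρ.continuous x
    have i₃ := (integrable_mul_comp_sub (μ := volume) huC.continuous hcd
      hdρ.continuous x).const_mul C
    have h₁ := integral_sub i₁ i₂
    have h₂ := integral_sub i₃ i₂
    rw [integral_const_mul, integral_fderiv_mul_comp_sub huC hρ1 hc, ← integral_const_mul, ← h₂]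
      at h₁
    convert h₁ using 3 <;> ring
  rw [hswap, lap_integral_mul_comp_sub huC.continuous hψc hψ]
  have hrefl : ∫ t, u t * lap N ψ (x - t) = ∫ t, u t * lap N (fun z => ψ (x - z)) t := by
    simp only [lap_comp_const_sub hψ]
  rw [hrefl]
  have hφzero (t) (ht : t ∉ closedBall x δ) : ψ (x - t) = 0 := by
    refine image_eq_zero_of_notMem_tsupport fun h => ht ?_
    have := hψsupp h
    rwa [mem_closedBall_zero_iff, ← dist_eq_norm, dist_comm] at this
  have hφsupp : tsupport (fun t => ψ (x - t)) ⊆ closedBall x δ := by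
    refine closure_minimal (fun t ht => ?_) isClosed_closedBall
    by_contra hn
    exact ht (hφzero t hn)
  rw [hweak (fun t => ψ (x - t)) (hψ.comp (contDiff_const.sub contDiff_id))
    (hφsupp.trans (hx.trans inter_subset_right)),
    setIntegral_eq_integral_of_forall_compl_eq_zero
      (fun t ht => hφzero t fun h => ht (hx h).1),
    integral_sub_left_eq_self ψ volume x, integral_sub, integral_const_mul,
    integral_fderiv_eq_zero_s13 hρ1 hc, hint]
  · simp
  · exact (hdρ.continuous.integrable_of_hasCompactSupport hcd).const_mul C
  · exact hρ.continuous.integrable_of_hasCompactSupport hc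

theorem exists_mollifier_close {N : ℕ} {W : EuclideanSpace ℝ (Fin N) → ℝ} (hW : Continuous W)
    {K : Set (EuclideanSpace ℝ (Fin N))} (hK : IsCompact K) {c δ : ℝ} (hc : 0 < c) (hδ : 0 < δ) :
    ∃ ρ : EuclideanSpace ℝ (Fin N) → ℝ, ContDiff ℝ (⊤ : ℕ∞) ρ ∧ tsupport ρ ⊆ closedBall 0 δ ∧
      ∫ t, ρ t = 1 ∧ ∀ x ∈ K, |(∫ t, W t * ρ (x - t)) - W x| ≤ c := by
  obtain ⟨η, hη, hWη⟩ : ∃ η > 0, ∀ x ∈ K, ∀ t, dist t x < η → dist (W t) (W x) < c := by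
    have hev := Metric.mem_uniformity_dist.1
      (hK.uniformContinuousAt_of_continuousAt W (fun x _ => hW.continuousAt)
        (Metric.dist_mem_uniformity hc))
    obtain ⟨η, hη, h⟩ := hev
    exact ⟨η, hη, fun x hx t ht => by
      rw [dist_comm]; exact h (by rwa [dist_comm]) hx⟩
  have hpos : 0 < min δ η := lt_min hδ hη
  let b : ContDiffBump (0 : EuclideanSpace ℝ (Fin N)) :=
    ⟨min δ η / 2, min δ η, half_pos hpos, half_lt_self hpos⟩
  refine ⟨b.normed volume, b.contDiff_normed, ?_, b.integral_normed, fun x hx => ?_⟩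
  · rw [b.tsupport_normed_eq]
    exact closedBall_subset_closedBall (min_le_left _ _)
  · have h := b.dist_normed_convolution_le (μ := volume) (x₀ := x) (ε := c)
      hW.aestronglyMeasurable
      (fun t ht => (hWη x hx t ((mem_ball.1 ht).trans_le (min_le_right _ _))).le)
    rw [convolution_lsmul_swap, Real.dist_eq] at h
    simpa [mul_comm] using h

/-- an almost-positivity of `C·D₁u − u` improves to positivity. -/
theorem directional_monotonicity (N : ℕ) (hN : 2 ≤ N) :
    ∃ ε₀ : ℝ, 0 < ε₀ ∧
      ∀ (M : ℝ), 0 < M →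
        ∀ (Ω : Set (EuclideanSpace ℝ (Fin N))) (u : EuclideanSpace ℝ (Fin N) → ℝ) (C : ℝ),
          MemP N 1 0 M Ω u → 0 < C →
            (∀ x ∈ ball (0 : EuclideanSpace ℝ (Fin N)) 1,
              -ε₀ ≤ C * fderiv ℝ u x (EuclideanSpace.single (⟨0, by omega⟩ : Fin N) 1) - u x) →
            ∀ x ∈ ball (0 : EuclideanSpace ℝ (Fin N)) (1 / 2),
              0 ≤ C * fderiv ℝ u x (EuclideanSpace.single (⟨0, by omega⟩ : Fin N) 1) - u x := by
  have hN0 : (0 : ℝ) < N := by exact_mod_cast (by omega : 0 < N)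
  refine ⟨1 / (128 * N), by positivity, fun M _ Ω u C hu _ hlow y hy => ?_⟩
  set e : EuclideanSpace ℝ (Fin N) := EuclideanSpace.single (⟨0, by omega⟩ : Fin N) 1
  set W : EuclideanSpace ℝ (Fin N) → ℝ := fun x => C * fderiv ℝ u x e - u x with hWdef
  have hW : Continuous W :=
    (continuous_const.mul ((hu.2.1.continuous_fderiv (by norm_num)).clm_apply
      continuous_const)).sub hu.2.1.continuous
  change 0 ≤ W y
  by_contra! hneg
  have hball : closedBall y (1 / 4) ⊆ ball 0 1 := fun x hx => by
    rw [mem_closedBall] at hx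
    rw [mem_ball] at hy ⊢
    linarith [dist_triangle x y 0]
  have hWoff (x) (hx : x ∈ ball (0 : EuclideanSpace ℝ (Fin N)) 1) (hxΩ : x ∉ Ω) : W x = 0 := by
    obtain ⟨h₁, h₂⟩ := hu.2.2.2.1 x ⟨hx, hxΩ⟩
    have h₃ : fderiv ℝ u x = 0 := by simpa [gradient] using h₂
    simp [hWdef, h₁, h₃]
  set a : ℝ := 1 / (4 * N) with ha
  have ha0 : 0 < a := by positivity
  obtain ⟨c, hc, hWy⟩ : ∃ c > 0, W y = -3 * c := ⟨-W y / 3, by linarith, by ring⟩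
  have hq : Continuous fun x : EuclideanSpace ℝ (Fin N) => a * ‖x - y‖ ^ 2 := by fun_prop
  set K := closedBall y (1 / 4) ∩ {x | W x + a * ‖x - y‖ ^ 2 ≤ -c}
  have hK : IsCompact K :=
    (isCompact_closedBall y _).inter_right (isClosed_le (hW.add hq) continuous_const)
  have hKU : K ⊆ Ω ∩ ball y (1 / 4) := by
    rintro x ⟨hx, hxw⟩
    rw [mem_ofPred_eq] at hxw
    have hq0 : 0 ≤ a * ‖x - y‖ ^ 2 := by positivity
    refine ⟨?_, ?_⟩
    · by_contra hxΩ
      have := hWoff x (hball hx) hxΩ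
      linarith
    · rw [mem_closedBall] at hx
      refine mem_ball.2 (lt_of_le_of_ne hx fun heq => ?_)
      have h₁ := hlow x (hball (mem_closedBall.2 hx))
      change _ ≤ W x at h₁
      rw [← dist_eq_norm, heq] at hxw
      have h₂ : 1 / (128 * (N : ℝ)) = a / 32 := by rw [ha]; field_simp; norm_num
      linarith
  obtain ⟨δ, hδ, hδU⟩ := hK.exists_cthickening_subset_open (hu.1.inter isOpen_ball) hKU
  obtain ⟨ρ, hρ, hsupp, hint, hclose⟩ :=
    exists_mollifier_close hW (isCompact_closedBall y (1 / 4)) hc hδ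
  have hρc : HasCompactSupport ρ := (isCompact_closedBall 0 δ).of_isClosed_subset
    (isClosed_tsupport ρ) hsupp
  set g : EuclideanSpace ℝ (Fin N) → ℝ := fun x => ∫ t, W t * ρ (x - t) with hg
  have hgC : ContDiff ℝ (⊤ : ℕ∞) g := contDiff_integral_mul_comp_sub hW hρc hρ
  have hqC : ContDiff ℝ (⊤ : ℕ∞) fun x : EuclideanSpace ℝ (Fin N) => a * ‖x - y‖ ^ 2 :=
    contDiff_const.mul ((contDiff_id.sub contDiff_const).norm_sq ℝ)
  have hvC := hgC.add hqC
  obtain ⟨x, hx, hxmin⟩ := (isCompact_closedBall y (1 / 4)).exists_isMinOn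
    ⟨y, mem_closedBall_self (by norm_num)⟩ hvC.continuous.continuousOn
  have hy' : y ∈ closedBall y (1 / 4) := mem_closedBall_self (by norm_num)
  have hxK : x ∈ K := by
    refine ⟨hx, ?_⟩
    have h₁ := abs_le.1 (hclose x hx)
    have h₂ := abs_le.1 (hclose y hy')
    have h₃ : g x + a * ‖x - y‖ ^ 2 ≤ g y + a * ‖y - y‖ ^ 2 := hxmin hy'
    simp only [sub_self, norm_zero] at h₃
    rw [mem_ofPred_eq]
    linarith [h₁.1, h₂.2]
  have hloc : IsLocalMin (fun x => g x + a * ‖x - y‖ ^ 2) x :=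
    hxmin.isLocalMin (mem_of_superset (isOpen_ball.mem_nhds (hKU hxK).2) ball_subset_closedBall)
  have hlap := hloc.lap_nonneg (hvC.of_le (WithTop.coe_le_coe.2 le_top))
  rw [lap_add hgC hqC, lap_const_mul_norm_sub_sq, hg,
    lap_mollified_eq_neg_one C hu hρ hsupp hint
      ((closedBall_subset_cthickening hxK δ).trans (hδU.trans
        (inter_subset_inter_right _ (ball_subset_closedBall.trans hball))))] at hlap
  have h₂ : 2 * a * N = 1 / 2 := by rw [ha]; field_simp; norm_num
  linarith
end
end
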